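/- arXiv:2403.04909 — 3 statements merged into one kernel-verified Lean document; each statement's English description precedes it below -/
import Mathlib

section
/- For every n ≥ 1, the second rank moment satisfies N₂(n) = 2n·p(n) − 2·spt(n), where p(n) is the number of partitions of n, spt(n) is the total number of appearances of the smallest part over all partitions of n, and N₂(n) = Σ_m m²·N(m,n) with N(m,n) the number of partitions of n with rank m. -/
/-- The rank of a partition: largest part minus number of parts. -/
def partitionRank {n : ℕ} (π : n.Partition) : ℤ :=
  (π.parts.sup : ℤ) - (π.parts.card : ℤ)

/-- The number of appearances of the smallest part of a partition. -/
noncomputable def smallestPartCount {n : ℕ} (π : n.Partition) : ℕ :=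
  π.parts.count (sInf {i | i ∈ π.parts})

namespace SptAux

/-- number of elements exceeding `j` -/
def cc (s : Multiset ℕ) (j : ℕ) : ℕ := s.countP (fun a => j < a)

lemma cc_anti (s : Multiset ℕ) {i j : ℕ} (h : i ≤ j) : cc s j ≤ cc s i := by
  unfold cc
  rw [Multiset.countP_eq_card_filter, Multiset.countP_eq_card_filter]
  apply Multiset.card_le_card
  exact Multiset.monotone_filter_right s (fun a ha => lt_of_le_of_lt h ha)

lemma lt_sup_iff (s : Multiset ℕ) (j : ℕ) : j < s.sup ↔ ∃ a ∈ s, j < a := by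
  rw [← not_le, Multiset.sup_le]; push Not; rfl

lemma cc_pos (s : Multiset ℕ) (j : ℕ) : 0 < cc s j ↔ j < s.sup := by
  rw [lt_sup_iff]; unfold cc; rw [Multiset.countP_pos]

lemma cc_succ (s : Multiset ℕ) (j : ℕ) : cc s j = s.count (j + 1) + cc s (j + 1) := by
  unfold cc
  induction s using Multiset.induction_on with
  | empty => simp
  | cons a s ih =>
    simp only [Multiset.countP_cons, Multiset.count_cons, ih]
    split_ifs <;> omega

lemma sum_cc (s : Multiset ℕ) (N : ℕ) (h : ∀ a ∈ s, a ≤ N) :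
    ∑ j ∈ Finset.range N, cc s j = s.sum := by
  induction s using Multiset.induction_on with
  | empty => simp [cc]
  | cons a s ih =>
    have h1 := ih (fun b hb => h b (Multiset.mem_cons_of_mem hb))
    have h2 := h a (Multiset.mem_cons_self a s)
    simp only [cc, Multiset.countP_cons, Finset.sum_add_distrib, Multiset.sum_cons] at h1 ⊢
    rw [h1, ← Finset.card_filter]
    have : Finset.filter (fun i => i < a) (Finset.range N) = Finset.range a := by
      ext x; simp; omega
    rw [this]; simp [add_comm]

/-- conjugate partition -/
def conj {n : ℕ} (π : n.Partition) : n.Partition where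
  parts := (Multiset.range π.parts.sup).map (cc π.parts)
  parts_pos := by
    intro i hi
    rw [Multiset.mem_map] at hi
    obtain ⟨j, hj, rfl⟩ := hi
    rw [Multiset.mem_range] at hj
    exact (cc_pos _ _).2 hj
  parts_sum := by
    have := sum_cc π.parts π.parts.sup (fun a ha => Multiset.le_sup ha)
    rw [π.parts_sum] at this
    exact this

lemma card_eq {n : ℕ} (π : n.Partition) : π.parts.card = cc π.parts 0 := by
  unfold cc
  rw [eq_comm, Multiset.countP_eq_card]
  intro a ha; exact π.parts_pos ha

lemma cc_conj {n : ℕ} (π : n.Partition) (i j : ℕ) :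
    j < cc (conj π).parts i ↔ i < cc π.parts j := by
  have h1 : cc (conj π).parts i =
      ((Finset.range π.parts.sup).filter (fun j => i < cc π.parts j)).card := by
    unfold cc conj
    simp only [Multiset.countP_map]
    rfl
  have hbd : ∀ j, i < cc π.parts j → j < π.parts.sup := fun j hj =>
    (cc_pos _ _).1 (by omega)
  rw [h1]
  constructor
  · intro h
    by_contra hc
    have : (Finset.range π.parts.sup).filter (fun j => i < cc π.parts j) ⊆ Finset.range j := by
      intro x hx
      simp only [Finset.mem_filter, Finset.mem_range] at hx ⊢
      by_contra hx'
      have := cc_anti π.parts (not_lt.1 hx')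
      omega
    have := Finset.card_le_card this
    simp only [Finset.card_range] at this
    omega
  · intro h
    have : Finset.range (j + 1) ⊆
        (Finset.range π.parts.sup).filter (fun j => i < cc π.parts j) := by
      intro x hx
      simp only [Finset.mem_filter, Finset.mem_range] at hx ⊢
      have := cc_anti π.parts (show x ≤ j by omega)
      have h3 : i < cc π.parts x := by omega
      exact ⟨hbd x h3, h3⟩
    have := Finset.card_le_card this
    simp only [Finset.card_range] at this
    omega

lemma ext_cc {n : ℕ} (π σ : n.Partition) (h : ∀ j, cc π.parts j = cc σ.parts j) : π = σ := by
  apply Nat.Partition.ext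
  ext a
  cases a with
  | zero =>
    rw [Multiset.count_eq_zero_of_notMem, Multiset.count_eq_zero_of_notMem]
    · intro h0; exact absurd (σ.parts_pos h0) (by simp)
    · intro h0; exact absurd (π.parts_pos h0) (by simp)
  | succ a =>
    have h1 := cc_succ π.parts a
    have h2 := cc_succ σ.parts a
    rw [h a, h (a + 1)] at h1
    omega

lemma eq_of_lt_iff {a b : ℕ} (h : ∀ i, i < a ↔ i < b) : a = b := by
  have h1 := h a
  have h2 := h b
  omega

lemma conj_conj {n : ℕ} (π : n.Partition) : conj (conj π) = π := by
  apply ext_cc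
  intro j
  apply eq_of_lt_iff
  intro i
  rw [cc_conj, cc_conj]

lemma sup_conj {n : ℕ} (π : n.Partition) : (conj π).parts.sup = π.parts.card := by
  apply eq_of_lt_iff
  intro i
  rw [← cc_pos, cc_conj, card_eq]

lemma card_conj {n : ℕ} (π : n.Partition) : (conj π).parts.card = π.parts.sup := by
  rw [← sup_conj, conj_conj]

lemma sum_conj {n : ℕ} (f : n.Partition → ℤ) : ∑ π, f (conj π) = ∑ π, f π :=
  Equiv.sum_comp (Function.Involutive.toPerm conj conj_conj) f

/-- largest minus second largest distinct part -/
def gap (s : Multiset ℕ) : ℕ := s.sup - (s.filter (fun a => a < s.sup)).sup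

lemma spt_eq {n : ℕ} (hn : 1 ≤ n) (π : n.Partition) :
    smallestPartCount π = gap (conj π).parts := by
  have hne : {i | i ∈ π.parts}.Nonempty := by
    by_contra hc
    rw [Set.not_nonempty_iff_eq_empty] at hc
    have h0 : π.parts = 0 := by
      apply Multiset.eq_zero_of_forall_notMem
      intro a ha
      have : a ∈ {i | i ∈ π.parts} := ha
      rw [hc] at this; exact this
    have := π.parts_sum
    rw [h0] at this; simp at this; omega
  unfold smallestPartCount gap
  rw [sup_conj]
  set s := sInf {i | i ∈ π.parts} with hs
  have hmem : s ∈ π.parts := Nat.sInf_mem hne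
  have hmin : ∀ a ∈ π.parts, s ≤ a := fun a ha => Nat.sInf_le ha
  have hspos := π.parts_pos hmem
  have hcpos : 0 < π.parts.count s := Multiset.count_pos.2 hmem
  have hlow : ∀ j, j < s → cc π.parts j = π.parts.card := by
    intro j hj
    unfold cc
    rw [Multiset.countP_eq_card]
    intro a ha
    exact lt_of_lt_of_le hj (hmin a ha)
  have h1 := cc_succ π.parts (s - 1)
  rw [hlow (s - 1) (by omega), Nat.sub_add_cancel hspos] at h1
  have key : ((conj π).parts.filter (fun a => a < π.parts.card)).sup = cc π.parts s := by
    apply eq_of_lt_iff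
    intro i
    rw [lt_sup_iff]
    simp only [Multiset.mem_filter, conj, Multiset.mem_map, Multiset.mem_range]
    constructor
    · rintro ⟨_, ⟨⟨j, hj, rfl⟩, hlt⟩, hi⟩
      have : s ≤ j := by
        by_contra hc
        rw [hlow j (by omega)] at hlt
        omega
      exact lt_of_lt_of_le hi (cc_anti _ this)
    · intro hi
      refine ⟨_, ⟨⟨s, (cc_pos _ _).1 (by omega), rfl⟩, by omega⟩, hi⟩
  rw [key]
  omega

/-- Sum over rooted partitions. -/
noncomputable def D (n : ℕ) (f : Multiset ℕ → ℕ → ℕ → ℤ) : ℤ :=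
  ∑ b ∈ Finset.Icc 1 n, ∑ k ∈ Finset.Icc 1 n,
    if b * k ≤ n then ∑ l : (n - b * k).Partition, f l.parts b k else 0

lemma remove_bij (n b k : ℕ) (hb : 1 ≤ b) (f : Multiset ℕ → ℤ) :
    ∑ π : n.Partition, (if k ≤ π.parts.count b then f (π.parts - Multiset.replicate k b) else 0) =
      if b * k ≤ n then ∑ l : (n - b * k).Partition, f l.parts else 0 := by
  rw [← Finset.sum_filter]
  have hle : ∀ π : n.Partition, k ≤ π.parts.count b →
      Multiset.replicate k b ≤ π.parts := fun π h => Multiset.le_count_iff_replicate_le.1 h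
  have hsum : ∀ π : n.Partition, k ≤ π.parts.count b →
      (π.parts - Multiset.replicate k b).sum + b * k = n := by
    intro π h
    have h2 := congrArg Multiset.sum (Multiset.sub_add_cancel (hle π h))
    rw [Multiset.sum_add, π.parts_sum, Multiset.sum_replicate, smul_eq_mul, mul_comm] at h2
    exact h2
  split_ifs with hbk
  · refine Finset.sum_bij'
      (fun π hπ => (⟨π.parts - Multiset.replicate k b, fun {i} hi =>
          π.parts_pos (Multiset.mem_of_le (Multiset.sub_le_self _ _) hi), by
          have := hsum π (Finset.mem_filter.1 hπ).2
          omega⟩ : (n - b * k).Partition))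
      (fun l _ => (⟨l.parts + Multiset.replicate k b, fun {i} hi => by
          rcases Multiset.mem_add.1 hi with h | h
          · exact l.parts_pos h
          · rw [Multiset.eq_of_mem_replicate h]; omega, by
          rw [Multiset.sum_add, l.parts_sum, Multiset.sum_replicate, smul_eq_mul, mul_comm k b]
          omega⟩ : n.Partition)) ?_ ?_ ?_ ?_ ?_
    · intros; simp
    · intros; simp
    · intro π hπ
      apply Nat.Partition.ext
      exact Multiset.sub_add_cancel (hle π (Finset.mem_filter.1 hπ).2)
    · intro l _
      apply Nat.Partition.ext
      simp
    · intros; rfl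
  · apply Finset.sum_eq_zero
    intro π hπ
    have := hsum π (Finset.mem_filter.1 hπ).2
    omega

lemma D_eq (n : ℕ) (f : Multiset ℕ → ℕ → ℕ → ℤ) :
    D n f = ∑ π : n.Partition, ∑ b ∈ Finset.Icc 1 n, ∑ k ∈ Finset.Icc 1 n,
      if k ≤ π.parts.count b then f (π.parts - Multiset.replicate k b) b k else 0 := by
  unfold D
  rw [Finset.sum_comm (s := (Finset.univ : Finset n.Partition))]
  apply Finset.sum_congr rfl
  intro b hb
  rw [Finset.sum_comm (s := (Finset.univ : Finset n.Partition))]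
  apply Finset.sum_congr rfl
  intro k _
  exact (remove_bij n b k (Finset.mem_Icc.1 hb).1 (fun s => f s b k)).symm

lemma part_le {n : ℕ} (π : n.Partition) {a : ℕ} (h : a ∈ π.parts) : a ≤ n := by
  have := Multiset.le_sum_of_mem h
  rwa [π.parts_sum] at this

lemma card_le {n : ℕ} (π : n.Partition) : π.parts.card ≤ n := by
  have := Multiset.card_nsmul_le_sum (s := π.parts) (a := 1) (fun x hx => π.parts_pos hx)
  rw [π.parts_sum] at this
  simpa using this

lemma count_le {n : ℕ} (π : n.Partition) (b : ℕ) : π.parts.count b ≤ n :=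
  (Multiset.count_le_card _ _).trans (card_le π)

lemma inner_sum {n : ℕ} (π : n.Partition) (b : ℕ) (c : ℤ) :
    ∑ k ∈ Finset.Icc 1 n, (if k ≤ π.parts.count b then c else 0) = π.parts.count b * c := by
  rw [← Finset.sum_filter]
  have : Finset.filter (fun k => k ≤ π.parts.count b) (Finset.Icc 1 n) =
      Finset.Icc 1 (π.parts.count b) := by
    have := count_le π b
    ext x; simp; omega
  rw [this]; simp

lemma sum_count {n : ℕ} (π : n.Partition) :
    ∑ b ∈ Finset.Icc 1 n, (π.parts.count b : ℤ) = π.parts.card := by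
  have := Multiset.sum_count_eq_card (s := Finset.Icc 1 n) (m := π.parts)
    (fun a ha => Finset.mem_Icc.2 ⟨π.parts_pos ha, part_le π ha⟩)
  exact_mod_cast this

lemma sum_count_mul {n : ℕ} (π : n.Partition) :
    ∑ b ∈ Finset.Icc 1 n, (π.parts.count b : ℤ) * b = n := by
  have h := Finset.sum_multiset_count_of_subset π.parts (Finset.Icc 1 n)
    (fun a ha => by
      rw [Multiset.mem_toFinset] at ha
      exact Finset.mem_Icc.2 ⟨π.parts_pos ha, part_le π ha⟩)
  rw [π.parts_sum] at h
  simp only [smul_eq_mul] at h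
  exact_mod_cast h.symm

lemma D_const (n : ℕ) (f : Multiset ℕ → ℕ → ℕ → ℤ) (g : n.Partition → ℤ)
    (h : ∀ π : n.Partition, ∀ b k, 1 ≤ b → 1 ≤ k → k ≤ π.parts.count b →
      f (π.parts - Multiset.replicate k b) b k = g π) :
    D n f = ∑ π : n.Partition, g π * π.parts.card := by
  rw [D_eq]
  apply Finset.sum_congr rfl
  intro π _
  rw [← sum_count, Finset.mul_sum]
  apply Finset.sum_congr rfl
  intro b hb
  rw [mul_comm, ← inner_sum]
  apply Finset.sum_congr rfl
  intro k hk
  split_ifs with hc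
  · exact h π b k (Finset.mem_Icc.1 hb).1 (Finset.mem_Icc.1 hk).1 hc
  · rfl

lemma D_b (n : ℕ) : D n (fun _ b _ => (b : ℤ)) = n * Fintype.card n.Partition := by
  rw [D_eq]
  simp only [inner_sum, sum_count_mul]
  simp [mul_comm]

lemma D_swap (n : ℕ) : D n (fun _ b _ => (b : ℤ)) = D n (fun _ _ k => (k : ℤ)) := by
  unfold D
  rw [Finset.sum_comm]
  apply Finset.sum_congr rfl
  intro b _
  apply Finset.sum_congr rfl
  intro k _
  rw [mul_comm k b]

lemma D_conj (n : ℕ) : D n (fun s _ _ => (s.sup : ℤ)) = D n (fun s _ _ => (s.card : ℤ)) := by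
  unfold D
  refine Finset.sum_congr rfl fun b _ => Finset.sum_congr rfl fun k _ => ?_
  split_ifs
  · rw [← sum_conj]
    simp only [sup_conj]
  · rfl

lemma D_add (n : ℕ) (f g : Multiset ℕ → ℕ → ℕ → ℤ) :
    D n (fun s b k => f s b k + g s b k) = D n f + D n g := by
  unfold D
  rw [← Finset.sum_add_distrib]
  refine Finset.sum_congr rfl fun b _ => ?_
  rw [← Finset.sum_add_distrib]
  refine Finset.sum_congr rfl fun k _ => ?_
  split_ifs
  · rw [Finset.sum_add_distrib]
  · simp

lemma D_gap (n : ℕ) (hn : 1 ≤ n) :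
    D n (fun s b _ => ((b - s.sup : ℕ) : ℤ)) = ∑ π : n.Partition, (gap π.parts : ℤ) := by
  rw [D_eq]
  apply Finset.sum_congr rfl
  intro π _
  set L := π.parts.sup with hL
  have hLmem : L ∈ π.parts := by
    have hpos : 0 < L := by
      by_contra hc
      have := sum_cc π.parts L (fun a ha => Multiset.le_sup ha)
      rw [π.parts_sum, Nat.eq_zero_of_not_pos hc] at this
      simp at this; omega
    obtain ⟨a, ha, hlt⟩ := (lt_sup_iff π.parts (L - 1)).1 (by omega)
    have : a ≤ L := Multiset.le_sup ha
    have : a = L := by omega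
    rwa [this] at ha
  have hm : 0 < π.parts.count L := Multiset.count_pos.2 hLmem
  have hzero : ∀ b k, k ≤ π.parts.count b → 1 ≤ k → (b ≠ L ∨ k ≠ π.parts.count L) →
      b - (π.parts - Multiset.replicate k b).sup = 0 := by
    intro b k hk hk1 hne
    have hb : b ≤ L := Multiset.le_sup (Multiset.count_pos.1 (by omega))
    have : L ∈ π.parts - Multiset.replicate k b := by
      rw [← Multiset.count_pos, Multiset.count_sub, Multiset.count_replicate]
      split_ifs with h
      · subst h; omega
      · omega
    have := Multiset.le_sup this
    omega
  rw [Finset.sum_eq_single L, Finset.sum_eq_single (π.parts.count L)]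
  · rw [if_pos le_rfl]
    unfold gap
    rw [← hL]
    have : π.parts - Multiset.replicate (π.parts.count L) L =
        π.parts.filter (fun a => a < L) := by
      ext a
      rw [Multiset.count_sub, Multiset.count_replicate, Multiset.count_filter]
      by_cases ha : a ∈ π.parts
      · have : a ≤ L := Multiset.le_sup ha
        split_ifs <;> first | omega | (subst_vars; omega)
      · rw [Multiset.count_eq_zero_of_notMem ha]; simp
    rw [this]
  · intro k hk hne
    split_ifs with h
    · rw [hzero L k h (Finset.mem_Icc.1 hk).1 (Or.inr hne)]; rfl
    · rfl
  · intro h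
    exact absurd (Finset.mem_Icc.2 ⟨hm, count_le π L⟩) h
  · intro b _ hne
    apply Finset.sum_eq_zero
    intro k hk
    split_ifs with h
    · rw [hzero b k h (Finset.mem_Icc.1 hk).1 (Or.inl hne)]; rfl
    · rfl
  · intro h
    exact absurd (Finset.mem_Icc.2 ⟨π.parts_pos hLmem, part_le π hLmem⟩) h

lemma D_Ll (n : ℕ) : D n (fun s b _ => (s.sup : ℤ) + ((b - s.sup : ℕ) : ℤ)) =
    ∑ π : n.Partition, (π.parts.sup : ℤ) * π.parts.card := by
  apply D_const
  intro π b k hb hk hc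
  have h := congrArg Multiset.sup
    (Multiset.sub_add_cancel (Multiset.le_count_iff_replicate_le.1 hc))
  have h2 : (Multiset.replicate k b).sup = b := by
    apply le_antisymm
    · rw [Multiset.sup_le]
      intro x hx; rw [Multiset.eq_of_mem_replicate hx]
    · apply Multiset.le_sup
      rw [Multiset.mem_replicate]; exact ⟨by omega, rfl⟩
  rw [Multiset.sup_add, h2] at h
  have h3 : max (π.parts - Multiset.replicate k b).sup b = π.parts.sup := h
  rw [← h3]
  have := max_def (π.parts - Multiset.replicate k b).sup b
  split_ifs at this <;> omega

lemma D_ll (n : ℕ) : D n (fun s _ k => (s.card : ℤ) + (k : ℤ)) =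
    ∑ π : n.Partition, (π.parts.card : ℤ) * π.parts.card := by
  apply D_const
  intro π b k hb hk hc
  have h := congrArg Multiset.card
    (Multiset.sub_add_cancel (Multiset.le_count_iff_replicate_le.1 hc))
  rw [Multiset.card_add, Multiset.card_replicate] at h
  exact_mod_cast h

end SptAux

/-- Andrews's identity: `N₂(n) = 2n·p(n) − 2·spt(n)`. -/
theorem stmt4 (n : ℕ) (hn : 1 ≤ n) :
    ∑ π : n.Partition, (partitionRank π) ^ 2 =
      2 * (n : ℤ) * (Fintype.card n.Partition : ℤ) -
        2 * ∑ π : n.Partition, (smallestPartCount π : ℤ) := by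
  have hspt : ∑ π : n.Partition, (smallestPartCount π : ℤ) =
      SptAux.D n (fun s b _ => ((b - s.sup : ℕ) : ℤ)) := by
    rw [SptAux.D_gap n hn, ← SptAux.sum_conj]
    exact Finset.sum_congr rfl fun π _ => by rw [SptAux.spt_eq hn, SptAux.conj_conj]
  have hLL : ∑ π : n.Partition, (π.parts.sup : ℤ) * π.parts.sup =
      ∑ π : n.Partition, (π.parts.card : ℤ) * π.parts.card := by
    rw [← SptAux.sum_conj]
    simp only [SptAux.sup_conj]
  have hrank : ∑ π : n.Partition, (partitionRank π) ^ 2 =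
      ∑ π : n.Partition, (π.parts.sup : ℤ) * π.parts.sup +
      ∑ π : n.Partition, (π.parts.card : ℤ) * π.parts.card -
      2 * ∑ π : n.Partition, (π.parts.sup : ℤ) * π.parts.card := by
    rw [Finset.mul_sum, ← Finset.sum_add_distrib, ← Finset.sum_sub_distrib]
    refine Finset.sum_congr rfl fun π _ => ?_
    unfold partitionRank
    ring
  have h1 := SptAux.D_Ll n
  have h2 := SptAux.D_ll n
  rw [SptAux.D_add] at h1 h2
  have h3 := SptAux.D_conj n
  have h4 := SptAux.D_b n
  rw [SptAux.D_swap] at h4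
  rw [hrank, hspt, hLL, ← h1, ← h2, h3, h4]
  ring
end

section
/- spt₃((5²·119+1)/24) ≡ 1 (mod 5), i.e. spt₃(124) ≡ 1 (mod 5). -/
/-- The Andrews–Garvan crank of a partition (for `n > 1`): if there are no ones, the
largest part; otherwise the number of parts larger than the number of ones, minus the
number of ones. -/
def partitionCrank {n : ℕ} (π : n.Partition) : ℤ :=
  let ω := π.parts.count 1
  if ω = 0 then (π.parts.sup : ℤ)
  else ((π.parts.filter (fun a => ω < a)).card : ℤ) - (ω : ℤ)

/-- Sixth symmetrized crank moment `μ₆(n) = Σ_m C(m+2,6)·M(m,n)`. -/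
noncomputable def mu6 (n : ℕ) : ℤ :=
  ∑ π : n.Partition, Ring.choose (partitionCrank π + 2) 6

/-- Sixth symmetrized rank moment `η₆(n) = Σ_m C(m+2,6)·N(m,n)`. -/
noncomputable def eta6 (n : ℕ) : ℤ :=
  ∑ π : n.Partition, Ring.choose (partitionRank π + 2) 6

open Finset

namespace Spt

/-- All partitions of all `n ≤ N`. -/
def allP (N : ℕ) : Finset (Σ n : ℕ, n.Partition) :=
  (range (N + 1)).sigma fun n => (univ : Finset n.Partition)

lemma mem_allP {N : ℕ} {s : Σ n : ℕ, n.Partition} : s ∈ allP N ↔ s.1 ≤ N := by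
  simp [allP]

lemma parts_mem {N : ℕ} {s : Σ n : ℕ, n.Partition} (hs : s ∈ allP N) {a : ℕ}
    (ha : a ∈ s.2.parts) : 1 ≤ a ∧ a ≤ N :=
  ⟨s.2.parts_pos ha, (Nat.Partition.le_of_mem_parts ha).trans (mem_allP.1 hs)⟩

lemma sum_counts {N : ℕ} {s : Σ n : ℕ, n.Partition} (hs : s ∈ allP N) :
    ∑ i ∈ range N, (i + 1) * s.2.parts.count (i + 1) = s.1 := by
  have h := Finset.sum_multiset_count_of_subset s.2.parts ((range N).image (· + 1)) (by
    intro a ha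
    have := parts_mem hs (Multiset.mem_toFinset.1 ha)
    simp only [mem_image, mem_range]
    exact ⟨a - 1, by omega, by omega⟩)
  rw [s.2.parts_sum, Finset.sum_image (by intro a _ b _ h; simpa using h)] at h
  refine Eq.trans ?_ h.symm
  exact Finset.sum_congr rfl fun i _ => by simp [mul_comm]

lemma card_counts {N : ℕ} {s : Σ n : ℕ, n.Partition} (hs : s ∈ allP N) :
    ∑ i ∈ range N, s.2.parts.count (i + 1) = s.2.parts.card := by
  rw [← Multiset.sum_count_eq_card (s := (range N).image (· + 1)) (m := s.2.parts)]
  · rw [Finset.sum_image (by intro a _ b _ h; simpa using h)]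
  · intro a ha
    have := parts_mem hs ha
    simp only [mem_image, mem_range]
    exact ⟨a - 1, by omega, by omega⟩

lemma genA {R : Type*} [CommRing R] (N : ℕ) (Q : R) (hQ : Q ^ (N + 1) = 0) (f : ℕ → ℕ → R) :
    ∑ s ∈ allP N, (∏ i ∈ range N, f (i + 1) (s.2.parts.count (i + 1))) * Q ^ s.1 =
      ∏ i ∈ range N, ∑ j ∈ range (N + 1), f (i + 1) j * Q ^ ((i + 1) * j) := by
  rw [Finset.prod_range, Finset.prod_univ_sum]
  refine Finset.sum_of_injOn (fun s (i : Fin N) => s.2.parts.count ((i : ℕ) + 1)) ?_ ?_ ?_ ?_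
  · rintro ⟨n, π⟩ hs ⟨n', π'⟩ hs' h
    have h1 : ∀ i < N, π.parts.count (i + 1) = π'.parts.count (i + 1) := fun i hi =>
      congrFun h ⟨i, hi⟩
    have e1 := sum_counts hs
    have e2 := sum_counts hs'
    have hn : n = n' := by
      rw [← show _ = n from e1, ← show _ = n' from e2]
      exact Finset.sum_congr rfl fun i hi => by rw [h1 i (mem_range.1 hi)]
    subst hn
    congr 1
    ext a
    by_cases ha : 1 ≤ a ∧ a ≤ N
    · have := h1 (a - 1) (by omega)
      rwa [Nat.sub_add_cancel ha.1] at this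
    · rw [Multiset.count_eq_zero_of_notMem fun h => ha (parts_mem hs h),
        Multiset.count_eq_zero_of_notMem fun h => ha (parts_mem hs' h)]
  · intro s hs
    rw [mem_coe, Fintype.mem_piFinset]
    intro i
    rw [mem_range]
    have h1 : s.2.parts.count ((i : ℕ) + 1) ≤ s.1 := by
      refine le_trans ?_ (sum_counts hs).le
      refine le_trans ?_ (Finset.single_le_sum (fun _ _ => Nat.zero_le _) (mem_range.2 i.2))
      exact Nat.le_mul_of_pos_left _ (Nat.succ_pos _)
    have := mem_allP.1 hs
    show s.2.parts.count ((i : ℕ) + 1) < N + 1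
    omega
  · intro c _ hc
    rw [Finset.prod_mul_distrib, Finset.prod_pow_eq_pow_sum]
    by_cases hle : ∑ i : Fin N, ((i : ℕ) + 1) * c i ≤ N
    · exfalso
      apply hc
      let m : Multiset ℕ := ∑ i : Fin N, Multiset.replicate (c i) ((i : ℕ) + 1)
      have hm : m.sum = ∑ i : Fin N, ((i : ℕ) + 1) * c i := by
        rw [Multiset.sum_sum]
        exact Finset.sum_congr rfl fun i _ => by simp [mul_comm]
      refine ⟨⟨m.sum, ⟨m, ?_, rfl⟩⟩, ?_, ?_⟩
      · intro i hi
        obtain ⟨j, _, hj⟩ := Multiset.mem_sum.1 hi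
        have := Multiset.eq_of_mem_replicate hj
        omega
      · exact mem_allP.2 (hm.trans_le hle)
      · funext i
        show Multiset.count ((i : ℕ) + 1) m = c i
        simp only [m]
        rw [Multiset.count_sum']
        simp only [Multiset.count_replicate]
        rw [Finset.sum_eq_single i]
        · simp
        · intro b _ hb
          rw [if_neg]
          intro h
          exact hb (Fin.ext (by omega))
        · simp
    · rw [pow_eq_zero_of_le (by omega) hQ, mul_zero]
  · intro s hs
    rw [Finset.prod_mul_distrib, Finset.prod_pow_eq_pow_sum,
      ← Finset.prod_range (fun i => f (i + 1) (s.2.parts.count (i + 1))),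
      ← Finset.sum_range (fun i => (i + 1) * s.2.parts.count (i + 1)), sum_counts hs]

/-- geometric series -/
def gs {R : Type*} [CommRing R] (N : ℕ) (Q x : R) (i : ℕ) : R :=
  ∑ j ∈ range (N + 1), (x * Q ^ i) ^ j

lemma gs_mul {R : Type*} [CommRing R] (N : ℕ) (Q x : R) (hQ : Q ^ (N + 1) = 0) (i : ℕ)
    (hi : 1 ≤ i) : gs N Q x i * (1 - x * Q ^ i) = 1 := by
  rw [gs, geom_sum_mul_neg, mul_pow, ← pow_mul, mul_comm i, pow_mul, hQ, zero_pow (by omega),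
    mul_zero, sub_zero]

lemma gs_pos {R : Type*} [CommRing R] (N : ℕ) (Q x : R) (hQ : Q ^ (N + 1) = 0) (i : ℕ)
    (hi : 1 ≤ i) : ∑ j ∈ range (N + 1), (if j = 0 then 0 else x ^ j) * Q ^ (i * j) =
      x * Q ^ i * gs N Q x i := by
  have h := gs_mul N Q x hQ i hi
  have h2 : ∑ j ∈ range (N + 1), (if j = 0 then 0 else x ^ j) * Q ^ (i * j) = gs N Q x i - 1 := by
    rw [gs, Finset.sum_range_succ', Finset.sum_range_succ']
    simp [mul_pow, pow_mul]
  rw [h2]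
  linear_combination h

lemma gs_all {R : Type*} [CommRing R] (N : ℕ) (Q x : R) (i : ℕ) :
    ∑ j ∈ range (N + 1), x ^ j * Q ^ (i * j) = gs N Q x i := by
  simp [gs, mul_pow, pow_mul]

lemma gs_none {R : Type*} [CommRing R] (N : ℕ) (Q : R) (i : ℕ) :
    ∑ j ∈ range (N + 1), (if j = 0 then 1 else 0) * Q ^ (i * j) = 1 := by
  rw [Finset.sum_eq_single 0] <;> simp +contextual

/-! Kernel program -/

def force {α : Type} (n : ℕ) (f : ℕ → α) : α := Nat.rec (f 0) (fun m _ => f (Nat.succ m)) n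

lemma force_eq {α : Type} (n : ℕ) (f : ℕ → α) : force n f = f n := by cases n <;> rfl

def gm (L K : ℕ) : ℕ → ℕ → ℕ → ℕ
  | 0, _, V => V
  | k + 1, s, V => cond (Nat.ble L s) V
      (force (Nat.land (Nat.add V (Nat.shiftLeft V s)) K) fun V' => gm L K k (Nat.mul 2 s) V')

def loop (K : ℕ) (st : ℕ → ℕ → ℕ) (sh : ℕ → ℕ) : ℕ → ℕ → ℕ → ℕ → ℕ
  | 0, _, _, T => T
  | k + 1, a, V, T => force (st a V) fun V' =>
      force (Nat.land (Nat.add T (Nat.shiftLeft V' (sh a))) K) fun T' =>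
        loop K st sh k (Nat.succ a) V' T'

def ploop (st : ℕ → ℕ → ℕ) : ℕ → ℕ → ℕ → ℕ
  | 0, _, V => V
  | k + 1, a, V => force (st a V) fun V' => ploop st k (Nat.succ a) V'

lemma land_cast (L n : ℕ) :
    ((Nat.land n (2 ^ L - 1) : ℕ) : ZMod (2 ^ L)) = (n : ZMod (2 ^ L)) := by
  have : Nat.land n (2 ^ L - 1) = n % 2 ^ L := Nat.and_two_pow_sub_one_eq_mod n L
  rw [this, ZMod.natCast_mod]

lemma shl_cast (L V s : ℕ) :
    ((Nat.shiftLeft V s : ℕ) : ZMod (2 ^ L)) = (V : ZMod (2 ^ L)) * 2 ^ s := by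
  have : Nat.shiftLeft V s = V * 2 ^ s := Nat.shiftLeft_eq V s
  rw [this]; push_cast; ring

lemma two_pow_zero (L s : ℕ) (h : L ≤ s) : (2 : ZMod (2 ^ L)) ^ s = 0 := by
  apply pow_eq_zero_of_le h
  have := ZMod.natCast_self (2 ^ L)
  push_cast at this
  exact this

lemma gm_spec (L : ℕ) (k s V : ℕ) (h : L ≤ s * 2 ^ k) (hs : 1 ≤ s) :
    ((gm L (2 ^ L - 1) k s V : ℕ) : ZMod (2 ^ L)) * (1 - 2 ^ s) = (V : ZMod (2 ^ L)) := by
  induction k generalizing s V with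
  | zero =>
    rw [two_pow_zero L s (by simpa using h)]; simp [gm]
  | succ k ih =>
    rw [gm]
    rcases hb : Nat.ble L s with _ | _
    · rw [cond_false, force_eq]
      have h2 := ih (Nat.mul 2 s) (Nat.land (Nat.add V (Nat.shiftLeft V s)) (2 ^ L - 1))
        (by show L ≤ 2 * s * 2 ^ k; rw [pow_succ] at h; linarith) (by show 1 ≤ 2 * s; omega)
      rw [land_cast] at h2
      have h3 : ((Nat.add V (Nat.shiftLeft V s) : ℕ) : ZMod (2 ^ L)) = V + V * 2 ^ s := by
        rw [← shl_cast]; exact Nat.cast_add _ _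
      rw [h3, show (2 : ZMod (2 ^ L)) ^ (Nat.mul 2 s) = 2 ^ (s + s) from congrArg _ (two_mul s),
        pow_add] at h2
      have hu : IsUnit (1 + (2 : ZMod (2 ^ L)) ^ s) := by
        apply IsNilpotent.isUnit_one_add
        refine ⟨L, ?_⟩
        rw [← pow_mul]
        exact two_pow_zero _ _ (Nat.le_mul_of_pos_left _ hs)
      apply hu.mul_right_cancel
      linear_combination h2
    · rw [cond_true, two_pow_zero L s (Nat.le_of_ble_eq_true hb)]; simp

lemma gm_eq (L : ℕ) (k s V : ℕ) (h : L ≤ s * 2 ^ k) (hs : 1 ≤ s) (g : ZMod (2 ^ L))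
    (hg : g * (1 - 2 ^ s) = 1) :
    ((gm L (2 ^ L - 1) k s V : ℕ) : ZMod (2 ^ L)) = V * g := by
  have := gm_spec L k s V h hs
  linear_combination g * this - (gm L (2 ^ L - 1) k s V : ZMod (2 ^ L)) * hg

lemma ploop_spec (L : ℕ) (st : ℕ → ℕ → ℕ) (P : ℕ → ZMod (2 ^ L)) (k a V : ℕ)
    (hst : ∀ c V : ℕ, a ≤ c → c < a + k → (V : ZMod (2 ^ L)) = P c →
      ((st c V : ℕ) : ZMod (2 ^ L)) = P (c + 1))
    (hV : (V : ZMod (2 ^ L)) = P a) : ((ploop st k a V : ℕ) : ZMod (2 ^ L)) = P (a + k) := by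
  induction k generalizing a V with
  | zero => simpa [ploop] using hV
  | succ k ih =>
    rw [ploop, force_eq]
    have := ih (Nat.succ a) (st a V) (fun c V h1 h2 => hst c V (by omega) (by omega))
      (hst a V le_rfl (by omega) hV)
    rw [this]; congr 1; omega

lemma loop_spec (L : ℕ) (st : ℕ → ℕ → ℕ) (sh : ℕ → ℕ) (P : ℕ → ZMod (2 ^ L)) (k a V T : ℕ)
    (hst : ∀ c V : ℕ, a ≤ c → c < a + k → (V : ZMod (2 ^ L)) = P c →
      ((st c V : ℕ) : ZMod (2 ^ L)) = P (c + 1))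
    (hV : (V : ZMod (2 ^ L)) = P a) :
    ((loop (2 ^ L - 1) st sh k a V T : ℕ) : ZMod (2 ^ L)) =
      T + ∑ c ∈ Ico a (a + k), 2 ^ sh c * P (c + 1) := by
  induction k generalizing a V T with
  | zero => simp [loop]
  | succ k ih =>
    rw [loop, force_eq, force_eq]
    have h1 := hst a V le_rfl (by omega) hV
    have := ih (Nat.succ a) (st a V) (Nat.land (Nat.add T (Nat.shiftLeft (st a V) (sh a)))
      (2 ^ L - 1)) (fun c V h1 h2 => hst c V (by omega) (by omega)) h1
    rw [this, land_cast]
    have h3 : ((Nat.add T (Nat.shiftLeft (st a V) (sh a)) : ℕ) : ZMod (2 ^ L)) =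
        T + st a V * 2 ^ sh a := by
      rw [← shl_cast]; exact Nat.cast_add _ _
    rw [h3, h1, show a + (k + 1) = Nat.succ a + k by omega,
      ← Finset.sum_Ioo_add_eq_sum_Ico (a := a) (by omega)]
    have : Ioo a (a.succ + k) = Ico a.succ (a.succ + k) := by
      ext x; simp only [mem_Ioo, mem_Ico]; omega
    rw [this]; ring

end Spt

namespace Spt

/-- exponent of `X ^ u * Q ^ i`, where `X = 2 ^ b`, `Q = X ^ d`. -/
def ex (b d u i : ℕ) : ℕ := Nat.mul b (Nat.add u (Nat.mul d i))

def prodProg (b d u L K : ℕ) (a k : ℕ) : ℕ := ploop (fun a V => gm L K 7 (ex b d u a) V) k a 1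

def rankProg (b d N L K : ℕ) : ℕ :=
  loop K (fun a V => gm L K 7 (ex b d 1 a) V)
    (fun a => ex b d (Nat.add 1 (Nat.sub N a)) a) N 1 1 (Nat.pow 2 (ex b d N 0))

/-- multiply by `1 - 2 ^ s`. -/
def mulSub (K V s : ℕ) : ℕ :=
  Nat.land (Nat.add V (Nat.sub (Nat.succ K) (Nat.land (Nat.shiftLeft V s) K))) K

def crankZProg (b d N L K T : ℕ) : ℕ :=
  loop K (fun a V => gm L K 7 (ex b d 0 a) V)
    (fun a => ex b d (Nat.add N a) a) (Nat.sub N 1) 2 1 (Nat.add T (Nat.pow 2 (ex b d N 0)))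

def crankWProg (b d N L K : ℕ) : ℕ :=
  force (prodProg b d 1 L K 2 (Nat.sub N 1)) fun V =>
  loop K (fun a V => force (mulSub K V (ex b d 1 a)) fun V' => gm L K 7 (ex b d 0 a) V')
    (fun a => ex b d (Nat.sub N a) a) (Nat.sub N 1) 2 V
      (Nat.land (Nat.shiftLeft V (ex b d (Nat.sub N 1) 1)) K)

def crankProg (b d N L K : ℕ) : ℕ :=
  force (crankWProg b d N L K) fun T => crankZProg b d N L K T

/-- `∑ e < k, w e * (digit e of D in base 2 ^ b)`. -/
def digsum (w : ℕ → ℕ) (b D : ℕ) : ℕ → ℕ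
  | 0 => 0
  | k + 1 => Nat.add (digsum w b D k)
      (Nat.mul (w k) (Nat.mod (Nat.shiftRight D (Nat.mul b k)) (Nat.pow 2 b)))

def final (w : ℕ → ℕ) (b d N T : ℕ) : ℕ :=
  force (Nat.shiftRight T (ex b d 0 N)) fun D => digsum w b D d

def withK (L : ℕ) (f : ℕ → ℕ) : ℕ := force (Nat.sub (Nat.pow 2 L) 1) f

def wR (e : ℕ) : ℕ := Nat.mul (Nat.div (Nat.sub 251 e) 5) (Nat.mod (Nat.sub 251 e) 5)
def wC (e : ℕ) : ℕ := Nat.mul (Nat.div (Nat.add e 3) 5) (Nat.mod (Nat.add e 3) 5)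

def rankVal (b d N L : ℕ) : ℕ :=
  withK L fun K => force (rankProg b d N L K) fun T => final wR b d N T

def crankVal (b d N L : ℕ) : ℕ :=
  withK L fun K => force (crankProg b d N L K) fun T => final wC b d N T

def cardVal (b N L : ℕ) : ℕ :=
  withK L fun K => force (prodProg b 1 0 L K 1 N) fun T =>
    digsum (fun _ => 1) b T (Nat.succ N)

lemma sup_mem (m : Multiset ℕ) (h : m ≠ 0) : m.sup ∈ m := by
  induction m using Multiset.induction_on with
  | empty => exact absurd rfl h
  | cons a m ih =>
    rw [Multiset.sup_cons]
    by_cases hm : m = 0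
    · subst hm; simp
    · rcases le_total a m.sup with h1 | h1
      · rw [sup_eq_right.2 h1]; exact Multiset.mem_cons_of_mem (ih hm)
      · rw [sup_eq_left.2 h1]; exact Multiset.mem_cons_self _ _

lemma prod_shift {R : Type*} [CommMonoid R] (N : ℕ) (F : ℕ → R) :
    ∏ i ∈ range N, F (i + 1) = ∏ i ∈ Ico 1 (N + 1), F i := by
  rw [Finset.prod_Ico_eq_prod_range]; simp [add_comm]

lemma genB {R : Type*} [CommRing R] (N : ℕ) (Q : R) (hQ : Q ^ (N + 1) = 0) (f : ℕ → ℕ → R) :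
    ∑ s ∈ allP N, (∏ i ∈ Ico 1 (N + 1), f i (s.2.parts.count i)) * Q ^ s.1 =
      ∏ i ∈ Ico 1 (N + 1), ∑ j ∈ range (N + 1), f i j * Q ^ (i * j) := by
  rw [← prod_shift N (fun i => ∑ j ∈ range (N + 1), f i j * Q ^ (i * j)), ← genA N Q hQ f]
  refine Finset.sum_congr rfl fun s _ => ?_
  rw [← prod_shift N (fun i => f i (s.2.parts.count i))]

lemma card_counts' {N : ℕ} {s : Σ n : ℕ, n.Partition} (hs : s ∈ allP N) (m : Multiset ℕ)
    (hm : m ≤ s.2.parts) : ∑ i ∈ Ico 1 (N + 1), m.count i = m.card := by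
  apply Multiset.sum_count_eq_card
  intro a ha
  have := parts_mem hs (Multiset.mem_of_le hm ha)
  simp only [mem_Ico]; omega

/-- local weights for the partitions with largest part `a` and all parts at least `m`. -/
def fM {R : Type*} [CommRing R] (x : R) (m a i j : ℕ) : R :=
  if i < a ∧ m ≤ i then x ^ j else if i = a ∧ m ≤ i then (if j = 0 then 0 else x ^ j)
    else if j = 0 then 1 else 0

lemma prod_fM {R : Type*} [CommRing R] (N : ℕ) (x : R) (m a : ℕ)
    (hm : 1 ≤ m) (ha : a ∈ insert 0 (Ico m (N + 1))) {s : Σ n : ℕ, n.Partition} (hs : s ∈ allP N) :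
    ∏ i ∈ Ico 1 (N + 1), fM x m a i (s.2.parts.count i) =
      if s.2.parts.sup = a ∧ ∀ p ∈ s.2.parts, m ≤ p then x ^ s.2.parts.card else 0 := by
  have hle : ∀ p ∈ s.2.parts, p ≤ s.2.parts.sup := fun p hp => Multiset.le_sup hp
  rw [mem_insert, mem_Ico] at ha
  split_ifs with h
  · obtain ⟨h1, h2⟩ := h
    rw [← card_counts' hs _ le_rfl, ← Finset.prod_pow_eq_pow_sum]
    refine Finset.prod_congr rfl fun i hi => ?_
    rw [mem_Ico] at hi
    rw [fM]
    split_ifs with h3 h4 h5 h6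
    · rfl
    · exfalso
      rw [Multiset.count_eq_zero] at h5
      apply h5
      rw [h4.1, ← h1]
      apply sup_mem
      intro h0
      rw [h0] at h1
      simp at h1
      omega
    · rfl
    · rw [h6, pow_zero]
    · exfalso
      have h7 : i ∈ s.2.parts := by
        by_contra h8; exact h6 (Multiset.count_eq_zero.2 h8)
      have := hle i h7
      have := h2 i h7
      omega
  · have key : ∃ i ∈ Ico 1 (N + 1), fM x m a i (s.2.parts.count i) = 0 := by
      by_cases h2 : ∀ p ∈ s.2.parts, m ≤ p
      · have h1 : s.2.parts.sup ≠ a := fun h1 => h ⟨h1, h2⟩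
        rcases lt_or_gt_of_ne h1 with h3 | h3
        · refine ⟨a, by rw [mem_Ico]; omega, ?_⟩
          have : a ∉ s.2.parts := fun h4 => absurd (hle a h4) (by omega)
          rw [fM, if_neg (by omega), if_pos (by omega), if_pos (Multiset.count_eq_zero.2 this)]
        · have h4 : s.2.parts.sup ∈ s.2.parts := by
            apply sup_mem
            intro h0
            rw [h0] at h3
            simp at h3
          have h5 := parts_mem hs h4
          refine ⟨s.2.parts.sup, by rw [mem_Ico]; omega, ?_⟩
          rw [fM, if_neg (by omega), if_neg (by omega), if_neg]
          rw [Multiset.count_eq_zero]; exact not_not.2 h4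
      · push Not at h2
        obtain ⟨p, hp, hpm⟩ := h2
        have h5 := parts_mem hs hp
        refine ⟨p, by rw [mem_Ico]; omega, ?_⟩
        rw [fM, if_neg (by omega), if_neg (by omega), if_neg]
        rw [Multiset.count_eq_zero]; exact not_not.2 hp
    obtain ⟨i, hi, hi0⟩ := key
    exact Finset.prod_eq_zero hi hi0

lemma sum_fM {R : Type*} [CommRing R] (N : ℕ) (Q x : R) (hQ : Q ^ (N + 1) = 0) (m a : ℕ)
    (hm : 1 ≤ m) (ha : a ∈ Ico m (N + 1)) :
    ∏ i ∈ Ico 1 (N + 1), ∑ j ∈ range (N + 1), fM x m a i j * Q ^ (i * j) =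
      x * Q ^ a * ∏ i ∈ Ico m (a + 1), gs N Q x i := by
  rw [mem_Ico] at ha
  have : ∀ i ∈ Ico 1 (N + 1), ∑ j ∈ range (N + 1), fM x m a i j * Q ^ (i * j) =
      (if i = a then x * Q ^ a else 1) * (if i ∈ Ico m (a + 1) then gs N Q x i else 1) := by
    intro i hi
    rw [mem_Ico] at hi
    by_cases h1 : i < a ∧ m ≤ i
    · rw [if_neg (by omega), if_pos (by rw [mem_Ico]; omega), one_mul, ← gs_all]
      exact Finset.sum_congr rfl fun j _ => by rw [fM, if_pos h1]
    · by_cases h2 : i = a ∧ m ≤ i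
      · rw [if_pos h2.1, if_pos (by rw [mem_Ico]; omega), ← h2.1, ← gs_pos N Q x hQ i hi.1]
        exact Finset.sum_congr rfl fun j _ => by rw [fM, if_neg (by omega), if_pos (by omega)]
      · rw [if_neg (by omega), if_neg (by rw [mem_Ico]; omega), one_mul, ← gs_none N Q i]
        exact Finset.sum_congr rfl fun j _ => by rw [fM, if_neg h1, if_neg h2]
  rw [Finset.prod_congr rfl this, Finset.prod_mul_distrib, Finset.prod_ite_eq',
    if_pos (by rw [mem_Ico]; omega), Finset.prod_ite_mem]
  congr 2
  ext i; simp only [mem_inter, mem_Ico]; omega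

lemma sum_fM_zero {R : Type*} [CommRing R] (N : ℕ) (Q x : R) (m : ℕ) (hm : 1 ≤ m) :
    ∏ i ∈ Ico 1 (N + 1), ∑ j ∈ range (N + 1), fM x m 0 i j * Q ^ (i * j) = 1 := by
  apply Finset.prod_eq_one
  intro i hi
  rw [mem_Ico] at hi
  rw [← gs_none N Q i]
  exact Finset.sum_congr rfl fun j _ => by rw [fM, if_neg (by omega), if_neg (by omega)]

lemma max_sum {R : Type*} [CommRing R] (N : ℕ) (Q x : R) (hQ : Q ^ (N + 1) = 0) (m : ℕ)
    (hm : 1 ≤ m) (y : ℕ → R) :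
    ∑ s ∈ allP N, (if ∀ p ∈ s.2.parts, m ≤ p then y s.2.parts.sup * x ^ s.2.parts.card else 0)
        * Q ^ s.1 =
      y 0 + ∑ a ∈ Ico m (N + 1), y a * (x * Q ^ a * ∏ i ∈ Ico m (a + 1), gs N Q x i) := by
  have h0 : (0 : ℕ) ∉ Ico m (N + 1) := by rw [mem_Ico]; omega
  have h1 : y 0 + ∑ a ∈ Ico m (N + 1), y a * (x * Q ^ a * ∏ i ∈ Ico m (a + 1), gs N Q x i) =
      ∑ a ∈ insert 0 (Ico m (N + 1)), y a *
        ∏ i ∈ Ico 1 (N + 1), ∑ j ∈ range (N + 1), fM x m a i j * Q ^ (i * j) := by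
    rw [Finset.sum_insert h0, sum_fM_zero N Q x m hm, mul_one]
    congr 1
    exact Finset.sum_congr rfl fun a ha => by rw [sum_fM N Q x hQ m a hm ha]
  rw [h1]
  simp_rw [← genB N Q hQ, Finset.mul_sum]
  rw [Finset.sum_comm]
  refine Finset.sum_congr rfl fun s hs => ?_
  have h2 : ∀ a ∈ insert 0 (Ico m (N + 1)),
      y a * ((∏ i ∈ Ico 1 (N + 1), fM x m a i (s.2.parts.count i)) * Q ^ s.1) =
      if s.2.parts.sup = a then
        (if ∀ p ∈ s.2.parts, m ≤ p then y a * x ^ s.2.parts.card else 0) * Q ^ s.1 else 0 := by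
    intro a ha
    rw [prod_fM N x m a hm ha hs]
    by_cases h3 : s.2.parts.sup = a <;> by_cases h4 : ∀ p ∈ s.2.parts, m ≤ p
    · rw [if_pos ⟨h3, h4⟩, if_pos h3, if_pos h4, mul_assoc]
    · rw [if_neg (fun h => h4 h.2), if_pos h3, if_neg h4]; ring
    · rw [if_neg (fun h => h3 h.1), if_neg h3]; ring
    · rw [if_neg (fun h => h3 h.1), if_neg h3]; ring
  rw [Finset.sum_congr rfl h2, Finset.sum_ite_eq]
  by_cases h4 : ∀ p ∈ s.2.parts, m ≤ p
  · rw [if_pos h4, if_pos]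
    by_cases h5 : s.2.parts = 0
    · simp [h5]
    · have h6 := sup_mem _ h5
      have := parts_mem hs h6
      have := h4 _ h6
      rw [mem_insert, mem_Ico]; omega
  · simp [h4]

/-- local weights for the partitions with exactly `w` ones. -/
def fW {R : Type*} [CommRing R] (x : R) (w i j : ℕ) : R :=
  if i = 1 then (if j = w then 1 else 0) else if i ≤ w then 1 else x ^ j

lemma prod_fW {R : Type*} [CommRing R] (N : ℕ) (hN : 1 ≤ N) (x : R) (w : ℕ) (hw : 1 ≤ w)
    {s : Σ n : ℕ, n.Partition} (hs : s ∈ allP N) :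
    ∏ i ∈ Ico 1 (N + 1), fW x w i (s.2.parts.count i) =
      if s.2.parts.count 1 = w then x ^ (s.2.parts.filter (fun a => w < a)).card else 0 := by
  split_ifs with h
  · rw [← card_counts' hs _ (Multiset.filter_le _ _), ← Finset.prod_pow_eq_pow_sum]
    refine Finset.prod_congr rfl fun i hi => ?_
    rw [Multiset.count_filter, fW]
    by_cases h1 : i = 1
    · subst h1
      rw [if_pos rfl, if_pos h, if_neg (by omega), pow_zero]
    · by_cases h2 : i ≤ w
      · rw [if_neg h1, if_pos h2, if_neg (by omega), pow_zero]
      · rw [if_neg h1, if_neg h2, if_pos (by omega)]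
  · apply Finset.prod_eq_zero (i := 1) (by rw [mem_Ico]; omega)
    rw [fW, if_pos rfl, if_neg h]

lemma sum_fW {R : Type*} [CommRing R] (N : ℕ) (hN : 1 ≤ N) (Q x : R) (w : ℕ)
    (hw : w ∈ Ico 1 (N + 1)) :
    ∏ i ∈ Ico 1 (N + 1), ∑ j ∈ range (N + 1), fW x w i j * Q ^ (i * j) =
      Q ^ w * ((∏ i ∈ Ico 2 (w + 1), gs N Q 1 i) * ∏ i ∈ Ico (w + 1) (N + 1), gs N Q x i) := by
  rw [mem_Ico] at hw
  rw [Finset.prod_eq_prod_Ico_succ_bot (by omega),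
    ← Finset.prod_Ico_consecutive _ (show 1 + 1 ≤ w + 1 by omega) (show w + 1 ≤ N + 1 by omega)]
  congr 1
  · rw [Finset.sum_eq_single w]
    · simp [fW]
    · intro b _ hb; simp [fW, hb]
    · intro h; exact absurd (mem_range.2 (by omega)) h
  · congr 1
    · refine Finset.prod_congr rfl fun i hi => ?_
      rw [mem_Ico] at hi
      rw [← gs_all]
      exact Finset.sum_congr rfl fun j _ => by
        rw [fW, if_neg (by omega), if_pos (by omega), one_pow]
    · refine Finset.prod_congr rfl fun i hi => ?_
      rw [mem_Ico] at hi
      rw [← gs_all]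
      exact Finset.sum_congr rfl fun j _ => by rw [fW, if_neg (by omega), if_neg (by omega)]

lemma ones_sum {R : Type*} [CommRing R] (N : ℕ) (hN : 1 ≤ N) (Q x : R) (hQ : Q ^ (N + 1) = 0)
    (y : ℕ → R) :
    ∑ s ∈ allP N, (if s.2.parts.count 1 = 0 then 0 else y (s.2.parts.count 1) *
        x ^ (s.2.parts.filter (fun a => s.2.parts.count 1 < a)).card) * Q ^ s.1 =
      ∑ w ∈ Ico 1 (N + 1), y w * (Q ^ w * ((∏ i ∈ Ico 2 (w + 1), gs N Q 1 i) *
        ∏ i ∈ Ico (w + 1) (N + 1), gs N Q x i)) := by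
  have h1 : ∀ w ∈ Ico 1 (N + 1), y w * (Q ^ w * ((∏ i ∈ Ico 2 (w + 1), gs N Q 1 i) *
        ∏ i ∈ Ico (w + 1) (N + 1), gs N Q x i)) = ∑ s ∈ allP N, if s.2.parts.count 1 = w then
        y w * x ^ (s.2.parts.filter (fun a => w < a)).card * Q ^ s.1 else 0 := by
    intro w hw
    rw [← sum_fW N hN Q x w hw, ← genB N Q hQ, Finset.mul_sum]
    rw [mem_Ico] at hw
    refine Finset.sum_congr rfl fun s hs => ?_
    rw [prod_fW N hN x w hw.1 hs]
    split_ifs <;> ring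
  rw [Finset.sum_congr rfl h1, Finset.sum_comm]
  refine Finset.sum_congr rfl fun s hs => ?_
  rw [Finset.sum_ite_eq]
  by_cases h0 : s.2.parts.count 1 = 0
  · rw [if_pos h0, if_neg (by rw [mem_Ico]; omega), zero_mul]
  · rw [if_neg h0, if_pos]
    have h2 : s.2.parts.count 1 ≤ N := by
      have h3 := card_counts' hs _ le_rfl
      have h4 : s.2.parts.count 1 ≤ s.1 := by
        refine le_trans ?_ (sum_counts hs).le
        refine le_trans ?_ (Finset.single_le_sum (fun _ _ => Nat.zero_le _)
          (mem_range.2 (show 0 < N by omega)))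
        simp
      exact h4.trans (mem_allP.1 hs)
    rw [mem_Ico]; omega

end Spt

namespace Spt

lemma ex_pow (L b d u i : ℕ) :
    (2 : ZMod (2 ^ L)) ^ ex b d u i = (2 ^ b) ^ u * ((2 ^ b) ^ d) ^ i := by
  show (2 : ZMod (2 ^ L)) ^ (b * (u + d * i)) = _
  rw [pow_mul, pow_add, pow_mul _ d i]

lemma Q_zero (b d N L : ℕ) (hL : L = b * (d * (N + 1))) :
    (((2 : ZMod (2 ^ L)) ^ b) ^ d) ^ (N + 1) = 0 := by
  rw [← pow_mul, ← pow_mul]; exact two_pow_zero _ _ hL.le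

lemma gm_gs (b d N L u a V : ℕ) (hL : L = b * (d * (N + 1))) (hN : N + 1 ≤ 128) (hb : 1 ≤ b)
    (hd : 1 ≤ d) (ha : 1 ≤ a) :
    ((gm L (2 ^ L - 1) 7 (ex b d u a) V : ℕ) : ZMod (2 ^ L)) =
      V * gs N ((2 ^ b) ^ d) ((2 ^ b) ^ u) a := by
  have h1 : b * d ≤ ex b d u a := by
    show b * d ≤ b * (u + d * a)
    apply Nat.mul_le_mul_left
    nlinarith
  have h0 : 1 ≤ b * d := Nat.mul_pos hb hd
  apply gm_eq
  · rw [hL, ← mul_assoc]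
    exact Nat.mul_le_mul h1 (by norm_num; omega)
  · omega
  · rw [ex_pow]
    exact gs_mul _ _ _ (Q_zero b d N L hL) a ha

lemma prodProg_spec (b d N L u a k : ℕ) (hL : L = b * (d * (N + 1))) (hN : N + 1 ≤ 128)
    (hb : 1 ≤ b) (hd : 1 ≤ d) (ha : 1 ≤ a) :
    ((prodProg b d u L (2 ^ L - 1) a k : ℕ) : ZMod (2 ^ L)) =
      ∏ i ∈ Ico a (a + k), gs N ((2 ^ b) ^ d) ((2 ^ b) ^ u) i := by
  rw [prodProg]
  refine ploop_spec L _ (fun c => ∏ i ∈ Ico a c, gs N ((2 ^ b) ^ d) ((2 ^ b) ^ u) i) k a 1 ?_ ?_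
  · intro c V h1 _ hV
    rw [gm_gs b d N L u c V hL hN hb hd (by omega), Finset.prod_Ico_succ_top h1, hV]
  · simp

lemma rankProg_spec (b d N L : ℕ) (hL : L = b * (d * (N + 1))) (hN : N + 1 ≤ 128)
    (hb : 1 ≤ b) (hd : 1 ≤ d) :
    ((rankProg b d N L (2 ^ L - 1) : ℕ) : ZMod (2 ^ L)) =
      ∑ s ∈ allP N, (2 ^ b) ^ (N - s.2.parts.sup + s.2.parts.card) * ((2 ^ b) ^ d) ^ s.1 := by
  have hQ := Q_zero b d N L hL
  have h := max_sum N (((2 : ZMod (2 ^ L)) ^ b) ^ d) (2 ^ b) hQ 1 le_rfl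
    (fun a => (2 ^ b) ^ (N - a))
  rw [rankProg, loop_spec L _ _
    (fun c => ∏ i ∈ Ico 1 c, gs N ((2 ^ b) ^ d) ((2 ^ b) ^ 1) i) N 1 1]
  · trans
    swap
    · trans
      · exact h.symm
      · refine Finset.sum_congr rfl fun s hs => ?_
        rw [if_pos (fun p hp => (parts_mem hs hp).1), pow_add]
    · have : ((Nat.pow 2 (ex b d N 0) : ℕ) : ZMod (2 ^ L)) = (2 ^ b) ^ N := by
        have := ex_pow L b d N 0
        rw [pow_zero, mul_one] at this
        rw [← this]; exact Nat.cast_pow 2 _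
      rw [this, Nat.sub_zero, add_comm 1 N]
      congr 1
      refine Finset.sum_congr rfl fun a ha => ?_
      rw [ex_pow, show Nat.add 1 (Nat.sub N a) = (N - a) + 1 from Nat.add_comm 1 (N - a),
        pow_succ, pow_one]
      ring
  · intro c V h1 _ hV
    rw [gm_gs b d N L 1 c V hL hN hb hd h1, Finset.prod_Ico_succ_top h1, hV]
  · simp

lemma mulSub_spec (L V s : ℕ) :
    ((mulSub (2 ^ L - 1) V s : ℕ) : ZMod (2 ^ L)) = V * (1 - 2 ^ s) := by
  rw [mulSub, land_cast]
  have h1 : Nat.succ (2 ^ L - 1) = 2 ^ L := Nat.sub_add_cancel Nat.one_le_two_pow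
  rw [h1]
  have h2 : Nat.land (Nat.shiftLeft V s) (2 ^ L - 1) ≤ 2 ^ L :=
    le_trans (Nat.and_le_right (n := Nat.shiftLeft V s)) (by omega)
  have h3 : ((Nat.sub (2 ^ L) (Nat.land (Nat.shiftLeft V s) (2 ^ L - 1)) : ℕ) : ZMod (2 ^ L)) =
      - (V * 2 ^ s) := by
    have h4 := Nat.cast_sub (R := ZMod (2 ^ L)) h2
    rw [land_cast, shl_cast, ZMod.natCast_self, zero_sub] at h4
    exact h4
  have h5 := Nat.cast_add (R := ZMod (2 ^ L)) V
    (Nat.sub (2 ^ L) (Nat.land (Nat.shiftLeft V s) (2 ^ L - 1)))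
  rw [h3] at h5
  rw [show Nat.add V _ = V + _ from rfl, h5]
  ring

/-- shifted crank -/
def ce (N : ℕ) {n : ℕ} (π : n.Partition) : ℕ :=
  if π.parts.count 1 = 0 then N + π.parts.sup
  else (N - π.parts.count 1) + (π.parts.filter (fun a => π.parts.count 1 < a)).card

lemma crankProg_spec (b d N L : ℕ) (hL : L = b * (d * (N + 1))) (hN : N + 1 ≤ 128)
    (hN1 : 1 ≤ N) (hb : 1 ≤ b) (hd : 1 ≤ d) :
    ((crankProg b d N L (2 ^ L - 1) : ℕ) : ZMod (2 ^ L)) =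
      ∑ s ∈ allP N, (2 ^ b) ^ (ce N s.2) * ((2 ^ b) ^ d) ^ s.1 := by
  have hQ := Q_zero b d N L hL
  have hZ := max_sum N (((2 : ZMod (2 ^ L)) ^ b) ^ d) 1 hQ 2 (by norm_num)
    (fun a => (2 ^ b) ^ (N + a))
  have hW := ones_sum N hN1 (((2 : ZMod (2 ^ L)) ^ b) ^ d) (2 ^ b) hQ
    (fun a => (2 ^ b) ^ (N - a))
  have hsplit : ∑ s ∈ allP N, ((2 : ZMod (2 ^ L)) ^ b) ^ (ce N s.2) * ((2 ^ b) ^ d) ^ s.1 =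
      (∑ s ∈ allP N, (if s.2.parts.count 1 = 0 then 0 else (2 ^ b) ^ (N - s.2.parts.count 1) *
        (2 ^ b) ^ (s.2.parts.filter (fun a => s.2.parts.count 1 < a)).card) *
          ((2 ^ b) ^ d) ^ s.1) +
      ∑ s ∈ allP N, (if ∀ p ∈ s.2.parts, 2 ≤ p then (2 ^ b) ^ (N + s.2.parts.sup) *
        1 ^ s.2.parts.card else 0) * ((2 ^ b) ^ d) ^ s.1 := by
    rw [← Finset.sum_add_distrib]
    refine Finset.sum_congr rfl fun s hs => ?_
    have hiff : (∀ p ∈ s.2.parts, 2 ≤ p) ↔ s.2.parts.count 1 = 0 := by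
      rw [Multiset.count_eq_zero]
      constructor
      · intro h h1; have := h 1 h1; omega
      · intro h p hp
        have := (parts_mem hs hp).1
        have : p ≠ 1 := fun h1 => h (h1 ▸ hp)
        omega
    rw [ce]
    by_cases h0 : s.2.parts.count 1 = 0
    · rw [if_pos h0, if_pos h0, if_pos (hiff.2 h0)]; simp
    · rw [if_neg h0, if_neg h0, if_neg (fun h => h0 (hiff.1 h)), pow_add]; ring
  rw [hsplit, hZ, hW]
  have e2 : 2 + Nat.sub N 1 = N + 1 := by show 2 + (N - 1) = N + 1; omega
  have hT : ((crankWProg b d N L (2 ^ L - 1) : ℕ) : ZMod (2 ^ L)) =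
      ∑ w ∈ Ico 1 (N + 1), (2 ^ b) ^ (N - w) * (((2 ^ b) ^ d) ^ w *
        ((∏ i ∈ Ico 2 (w + 1), gs N ((2 ^ b) ^ d) 1 i) *
        ∏ i ∈ Ico (w + 1) (N + 1), gs N ((2 ^ b) ^ d) (2 ^ b) i)) := by
    rw [crankWProg, force_eq]
    have hV := prodProg_spec b d N L 1 2 (Nat.sub N 1) hL hN hb hd (by norm_num)
    rw [e2, pow_one] at hV
    rw [loop_spec L _ _ (fun c => (∏ i ∈ Ico 2 c, gs N ((2 ^ b) ^ d) 1 i) *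
        ∏ i ∈ Ico c (N + 1), gs N ((2 ^ b) ^ d) (2 ^ b) i) (Nat.sub N 1) 2]
    · rw [Finset.sum_eq_sum_Ico_succ_bot (show 1 < N + 1 by omega), land_cast, shl_cast, hV,
        ex_pow, e2]
      congr 1
      · simp only [Nat.reduceAdd, Ico_self, prod_empty, Nat.sub_eq]; ring
      · refine Finset.sum_congr rfl fun a ha => ?_
        rw [ex_pow]; simp only [Nat.sub_eq]; ring
    · intro c V h1 h2 hVc
      rw [e2] at h2
      rw [force_eq, gm_gs b d N L 0 c _ hL hN hb hd (by omega), mulSub_spec, hVc, ex_pow, pow_zero,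
        Finset.prod_Ico_succ_top h1, Finset.prod_eq_prod_Ico_succ_bot h2, pow_one]
      have := gs_mul N (((2 : ZMod (2 ^ L)) ^ b) ^ d) (2 ^ b) hQ c (by omega)
      linear_combination (∏ i ∈ Ico 2 c, gs N (((2 : ZMod (2 ^ L)) ^ b) ^ d) 1 i) *
        (∏ i ∈ Ico (c + 1) (N + 1), gs N (((2 : ZMod (2 ^ L)) ^ b) ^ d) (2 ^ b) i) *
        gs N (((2 : ZMod (2 ^ L)) ^ b) ^ d) 1 c * this
    · rw [hV]; simp
  rw [crankProg, force_eq, crankZProg, loop_spec L _ _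
    (fun c => ∏ i ∈ Ico 2 c, gs N ((2 ^ b) ^ d) ((2 ^ b) ^ 0) i) (Nat.sub N 1) 2 1]
  · have h3 : ((Nat.pow 2 (ex b d N 0) : ℕ) : ZMod (2 ^ L)) = (2 ^ b) ^ N := by
      have := ex_pow L b d N 0
      rw [pow_zero, mul_one] at this
      rw [← this]; exact Nat.cast_pow 2 _
    have h4 := Nat.cast_add (R := ZMod (2 ^ L)) (crankWProg b d N L (2 ^ L - 1))
      (Nat.pow 2 (ex b d N 0))
    rw [h3, hT] at h4
    rw [show Nat.add _ _ = crankWProg b d N L (2 ^ L - 1) + _ from rfl, h4, e2, add_assoc,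
      Nat.add_zero]
    congr 2
    refine Finset.sum_congr rfl fun a ha => ?_
    rw [ex_pow, pow_zero, one_mul]
    simp only [Nat.add_eq]; ring
  · intro c V h1 _ hV
    rw [gm_gs b d N L 0 c V hL hN hb hd (by omega), Finset.prod_Ico_succ_top h1, hV]
  · simp

lemma digit {ι : Type*} (S : Finset ι) (E : ι → ℕ) (b K L T : ℕ) (hL : L = b * K)
    (hc : S.card < 2 ^ b)
    (hT : (T : ZMod (2 ^ L)) = ∑ s ∈ S, ((2 : ZMod (2 ^ L)) ^ b) ^ E s) (i : ℕ) (hi : i < K) :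
    T / (2 ^ b) ^ i % 2 ^ b = (S.filter (fun s => E s = i)).card := by
  have h1 : T ≡ ∑ s ∈ S, (2 ^ b) ^ E s [MOD 2 ^ L] := by
    rw [← ZMod.natCast_eq_natCast_iff, hT]; push_cast; rfl
  have h2 : T ≡ ∑ s ∈ S, (2 ^ b) ^ E s [MOD (2 ^ b) ^ i * 2 ^ b] := by
    refine h1.of_dvd ?_
    rw [← pow_succ, hL, pow_mul]
    exact pow_dvd_pow _ hi
  rw [← Nat.mod_mul_right_div_self, h2, Nat.mod_mul_right_div_self]
  generalize 2 ^ b = X at *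
  have hX : 0 < X := by omega
  rw [← Finset.sum_filter_add_sum_filter_not S (fun s => E s < i),
    ← Finset.sum_filter_add_sum_filter_not (S.filter fun s => ¬ E s < i) (fun s => E s = i)]
  have hA : ∑ s ∈ S.filter (fun s => E s < i), X ^ E s < X ^ i := by
    rcases Nat.eq_zero_or_pos i with h0 | h0
    · subst h0; simp
    · obtain ⟨k, rfl⟩ : ∃ k, i = k + 1 := ⟨i - 1, by omega⟩
      calc ∑ s ∈ S.filter (fun s => E s < k + 1), X ^ E s
          ≤ ∑ s ∈ S.filter (fun s => E s < k + 1), X ^ k := by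
            refine Finset.sum_le_sum fun s hs => Nat.pow_le_pow_right hX ?_
            have := (mem_filter.1 hs).2
            omega
        _ = (S.filter (fun s => E s < k + 1)).card * X ^ k := by simp
        _ ≤ S.card * X ^ k := Nat.mul_le_mul_right _ (card_filter_le _ _)
        _ < X * X ^ k := Nat.mul_lt_mul_of_pos_right hc (by positivity)
        _ = X ^ (k + 1) := by rw [pow_succ, mul_comm]
  have hf : (S.filter fun s => ¬ E s < i).filter (fun s => E s = i) =
      S.filter (fun s => E s = i) := by
    ext s; simp only [mem_filter]
    constructor
    · rintro ⟨⟨h, -⟩, h'⟩; exact ⟨h, h'⟩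
    · rintro ⟨h, h'⟩; exact ⟨⟨h, by omega⟩, h'⟩
  have hB : ∑ s ∈ S.filter (fun s => E s = i), X ^ E s =
      X ^ i * (S.filter (fun s => E s = i)).card := by
    rw [Finset.sum_congr rfl (g := fun _ => X ^ i) fun s hs => by rw [(mem_filter.1 hs).2]]
    simp [mul_comm]
  obtain ⟨C, hC⟩ : X ^ (i + 1) ∣
      ∑ s ∈ (S.filter fun s => ¬ E s < i).filter (fun s => ¬ E s = i), X ^ E s := by
    refine Finset.dvd_sum fun s hs => pow_dvd_pow _ ?_
    simp only [mem_filter] at hs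
    omega
  rw [hf, hB, hC, pow_succ, mul_assoc, ← mul_add,
    Nat.add_mul_div_left _ _ (by positivity), Nat.div_eq_of_lt hA, zero_add, Nat.add_mul_mod_self_left]
  exact Nat.mod_eq_of_lt ((card_filter_le _ _).trans_lt hc)

lemma digsum_eq (w : ℕ → ℕ) (b D k : ℕ) :
    digsum w b D k = ∑ e ∈ range k, w e * (D / (2 ^ b) ^ e % 2 ^ b) := by
  induction k with
  | zero => rfl
  | succ k ih =>
    rw [Finset.sum_range_succ, ← ih, digsum]
    show _ + w k * ((D >>> (b * k)) % 2 ^ b) = _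
    rw [Nat.shiftRight_eq_div_pow, pow_mul]

lemma assemble (w : ℕ → ℕ) (b d N L T : ℕ) (e : ∀ n : ℕ, n.Partition → ℕ)
    (hL : L = b * (d * (N + 1))) (hc : (allP N).card < 2 ^ b)
    (he : ∀ s ∈ allP N, e s.1 s.2 < d)
    (hT : (T : ZMod (2 ^ L)) =
      ∑ s ∈ allP N, ((2 : ZMod (2 ^ L)) ^ b) ^ (e s.1 s.2) * ((2 ^ b) ^ d) ^ s.1) :
    final w b d N T = ∑ π : N.Partition, w (e N π) := by
  have hT' : (T : ZMod (2 ^ L)) =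
      ∑ s ∈ allP N, ((2 : ZMod (2 ^ L)) ^ b) ^ (e s.1 s.2 + d * s.1) := by
    rw [hT]
    exact Finset.sum_congr rfl fun s _ => by rw [pow_add, pow_mul _ d]
  rw [final, force_eq, digsum_eq]
  have h1 : ∀ k ∈ range d, w k * (Nat.shiftRight T (ex b d 0 N) / (2 ^ b) ^ k % 2 ^ b) =
      ∑ π : N.Partition, if e N π = k then w k else 0 := by
    intro k hk
    rw [mem_range] at hk
    have h2 : Nat.shiftRight T (ex b d 0 N) = T / (2 ^ b) ^ (d * N) := by
      show T >>> (b * (0 + d * N)) = _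
      rw [Nat.shiftRight_eq_div_pow, zero_add, pow_mul]
    rw [h2, Nat.div_div_eq_div_mul, ← pow_add, digit (allP N) _ b (d * (N + 1)) L T hL hc hT'
      (d * N + k) (by rw [mul_add]; omega), ← Finset.sum_filter, Finset.sum_const, smul_eq_mul,
      mul_comm]
    congr 1
    symm
    refine Finset.card_bij (fun π _ => ⟨N, π⟩) ?_ ?_ ?_
    · intro π hπ
      rw [mem_filter] at hπ ⊢
      exact ⟨mem_allP.2 le_rfl, by rw [hπ.2, add_comm]⟩
    · intro π _ π' _ h
      simpa using h
    · rintro ⟨n, π⟩ hs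
      rw [mem_filter] at hs
      obtain ⟨hs, h3⟩ := hs
      have h4 := he _ hs
      have h5 := mem_allP.1 hs
      simp only at h3 h4 h5
      have h6 : n = N := by
        by_contra hne
        have : n + 1 ≤ N := by omega
        have := Nat.mul_le_mul_left d this
        rw [mul_add] at this
        omega
      subst h6
      exact ⟨π, by rw [mem_filter]; exact ⟨mem_univ _, by omega⟩, rfl⟩
  rw [Finset.sum_congr rfl h1, Finset.sum_comm]
  refine Finset.sum_congr rfl fun π _ => ?_
  rw [Finset.sum_ite_eq, if_pos]
  exact mem_range.2 (he ⟨N, π⟩ (mem_allP.2 le_rfl))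

lemma card_partition_le (n : ℕ) : Fintype.card n.Partition ≤ 2 ^ (n - 1) := by
  rw [← composition_card]
  exact Fintype.card_le_of_surjective _ Nat.Partition.ofComposition_surj

lemma card_allP_crude (N : ℕ) : (allP N).card ≤ 2 ^ N := by
  induction N with
  | zero => simp [allP]
  | succ N ih =>
    have : (allP (N + 1)).card = (allP N).card + Fintype.card (N + 1).Partition := by
      simp only [allP, Finset.card_sigma]
      rw [Finset.sum_range_succ]; rfl
    have h := card_partition_le (N + 1)
    rw [Nat.add_sub_cancel] at h
    rw [this, pow_succ]; omega

lemma card_allP_eq (b N L : ℕ) (hL : L = b * (1 * (N + 1))) (hN : N + 1 ≤ 128) (hb : N < b) :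
    digsum (fun _ => 1) b (prodProg b 1 0 L (2 ^ L - 1) 1 N) (N + 1) = (allP N).card := by
  rw [digsum_eq]
  have hQ := Q_zero b 1 N L hL
  have hT : ((prodProg b 1 0 L (2 ^ L - 1) 1 N : ℕ) : ZMod (2 ^ L)) =
      ∑ s ∈ allP N, ((2 : ZMod (2 ^ L)) ^ b) ^ s.1 := by
    rw [prodProg_spec b 1 N L 0 1 N hL hN (by omega) le_rfl le_rfl]
    have h := genB N (((2 : ZMod (2 ^ L)) ^ b) ^ 1) hQ (fun _ _ => 1)
    simp only [Finset.prod_const_one, one_mul, pow_one] at h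
    rw [h, add_comm 1 N]
    refine Finset.prod_congr rfl fun i _ => ?_
    rw [← gs_all]; simp
  have hcard : (allP N).card < 2 ^ b :=
    (card_allP_crude N).trans_lt (Nat.pow_lt_pow_right (by norm_num) hb)
  rw [Finset.card_eq_sum_card_fiberwise (f := fun s => s.1) (t := range (N + 1))]
  · refine Finset.sum_congr rfl fun i hi => ?_
    rw [one_mul, digit (allP N) (fun s => s.1) b (N + 1) L _ (by rw [hL, one_mul]) hcard hT i
      (mem_range.1 hi)]
  · intro s hs
    have := mem_allP.1 hs
    simp only [coe_range, Set.mem_Iio]; omega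

end Spt


namespace Spt

lemma card_allP_val (b N L : ℕ) (hL : L = b * (1 * (N + 1))) (hN : N + 1 ≤ 128) (hb : N < b) :
    cardVal b N L = (allP N).card := by
  rw [cardVal, withK, force_eq, force_eq]
  exact card_allP_eq b N L hL hN hb

lemma rankVal_eq (b d N L : ℕ) (hL : L = b * (d * (N + 1))) (hN : N + 1 ≤ 128) (hb : 1 ≤ b)
    (hd : 2 * N < d) (hc : (allP N).card < 2 ^ b) :
    rankVal b d N L = ∑ π : N.Partition, wR (N - π.parts.sup + π.parts.card) := by
  rw [rankVal, withK, force_eq, force_eq]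
  refine assemble wR b d N L _ (fun n π => N - π.parts.sup + π.parts.card) hL hc ?_
    (rankProg_spec b d N L hL hN hb (by omega))
  intro s hs
  have h1 := card_counts' hs _ le_rfl
  have h2 := sum_counts hs
  have h3 := mem_allP.1 hs
  have h4 : s.2.parts.card ≤ s.1 := by
    refine le_trans ?_ h2.le
    rw [← card_counts hs]
    exact Finset.sum_le_sum fun i _ => Nat.le_mul_of_pos_left _ (Nat.succ_pos _)
  omega

lemma crankVal_eq (b d N L : ℕ) (hL : L = b * (d * (N + 1))) (hN : N + 1 ≤ 128) (hN1 : 1 ≤ N)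
    (hb : 1 ≤ b) (hd : 2 * N < d) (hc : (allP N).card < 2 ^ b) :
    crankVal b d N L = ∑ π : N.Partition, wC (ce N π) := by
  rw [crankVal, withK, force_eq, force_eq]
  refine assemble wC b d N L _ (fun n π => ce N π) hL hc ?_
    (crankProg_spec b d N L hL hN hN1 hb (by omega))
  intro s hs
  have h2 := sum_counts hs
  have h3 := mem_allP.1 hs
  have h4 : s.2.parts.card ≤ s.1 := by
    refine le_trans ?_ h2.le
    rw [← card_counts hs]
    exact Finset.sum_le_sum fun i _ => Nat.le_mul_of_pos_left _ (Nat.succ_pos _)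
  have h5 : (s.2.parts.filter (fun a => s.2.parts.count 1 < a)).card ≤ s.2.parts.card :=
    Multiset.card_le_card (Multiset.filter_le _ _)
  have h6 : s.2.parts.sup ≤ N := Multiset.sup_le.2 fun a ha => (parts_mem hs ha).2
  show ce N s.2 < d
  rw [ce]
  split_ifs <;> omega

theorem card_num : Nat.ble (cardVal 125 124 15625) 68719476735 = true := by decide +kernel
theorem rank_num : Nat.mod (rankVal 36 250 124 1125000) 5 = 4 := by decide +kernel
theorem crank_num : Nat.mod (crankVal 36 250 124 1125000) 5 = 0 := by decide +kernel

lemma card_lt : (allP 124).card < 2 ^ 36 := by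
  have h := Nat.le_of_ble_eq_true card_num
  rw [card_allP_val 125 124 15625 (by norm_num) (by norm_num) (by norm_num)] at h
  omega

/-- computable form of the binomial coefficient -/
def cz (r : ℤ) : ℤ := match r - 5 with
  | Int.ofNat n => ((n + 5).choose 6 : ℕ)
  | Int.negSucc n => ((n + 1).choose 6 : ℕ)

lemma choose_cz (r : ℤ) : Ring.choose r 6 = cz r := by
  rw [cz]
  rcases h : r - 5 with n | n
  · have : r = ((n + 5 : ℕ) : ℤ) := by rw [Int.ofNat_eq_natCast] at h; push_cast; omega
    rw [this, Ring.choose_natCast]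
  · have : r = -((n + 1 : ℕ) : ℤ) + 5 := by rw [Int.negSucc_eq] at h; push_cast; omega
    have h0 : Ring.choose r 6 = Int.multichoose (r - 6 + 1) 6 := rfl
    have h1 : r - 6 + 1 = Int.negSucc n := by omega
    have h2 : Int.negOnePow ((6 : ℕ) : ℤ) = 1 := Int.negOnePow_even _ ⟨3, rfl⟩
    rw [h0, h1, Int.multichoose, h2]
    simp

lemma wR_spec : ∀ e : ℕ, e < 250 → (cz (126 - (e : ℤ)) - (wR e : ℤ)) % 5 = 0 := by decide +kernel
lemma wC_spec : ∀ e : ℕ, e < 250 → (cz ((e : ℤ) - 122) - (wC e : ℤ)) % 5 = 0 := by decide +kernel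

lemma bounds (N : ℕ) (π : N.Partition) : π.parts.card ≤ N ∧ π.parts.sup ≤ N ∧
    π.parts.count 1 ≤ N := by
  have hs : (⟨N, π⟩ : Σ n : ℕ, n.Partition) ∈ allP N := mem_allP.2 le_rfl
  have h4 : π.parts.card ≤ N := by
    refine le_trans ?_ (sum_counts hs).le
    rw [← card_counts hs]
    exact Finset.sum_le_sum fun i _ => Nat.le_mul_of_pos_left _ (Nat.succ_pos _)
  exact ⟨h4, Multiset.sup_le.2 fun a ha => (parts_mem hs ha).2,
    (Multiset.count_le_card _ _).trans h4⟩

lemma mod_conv (v r : ℕ) (h : Nat.mod v 5 = r) : v % 5 = r := h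

lemma eta_mod : eta6 124 ≡ 4 [ZMOD 5] := by
  have h1 : eta6 124 ≡ ((rankVal 36 250 124 1125000 : ℕ) : ℤ) [ZMOD 5] := by
    rw [rankVal_eq 36 250 124 1125000 (by norm_num) (by norm_num) (by norm_num) (by norm_num)
      card_lt, eta6]
    push_cast
    refine Int.ModEq.sum fun π _ => ?_
    obtain ⟨b1, b2, -⟩ := bounds 124 π
    have h := wR_spec (124 - π.parts.sup + π.parts.card) (by omega)
    have e1 : partitionRank π + 2 =
        126 - ((124 - π.parts.sup + π.parts.card : ℕ) : ℤ) := by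
      rw [partitionRank]; omega
    rw [choose_cz, e1]
    unfold Int.ModEq; omega
  have h2 : rankVal 36 250 124 1125000 % 5 = 4 := mod_conv _ _ rank_num
  refine h1.trans ?_
  generalize rankVal 36 250 124 1125000 = v at h2
  unfold Int.ModEq; omega

lemma mu_mod : mu6 124 ≡ 0 [ZMOD 5] := by
  have h1 : mu6 124 ≡ ((crankVal 36 250 124 1125000 : ℕ) : ℤ) [ZMOD 5] := by
    rw [crankVal_eq 36 250 124 1125000 (by norm_num) (by norm_num) (by norm_num) (by norm_num)
      (by norm_num) card_lt, mu6]
    push_cast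
    refine Int.ModEq.sum fun π _ => ?_
    obtain ⟨b1, b2, b3⟩ := bounds 124 π
    have h5 : (π.parts.filter (fun a => π.parts.count 1 < a)).card ≤ π.parts.card :=
      Multiset.card_le_card (Multiset.filter_le _ _)
    have h := wC_spec (ce 124 π) (by rw [ce]; split_ifs <;> omega)
    have e1 : partitionCrank π + 2 = (ce 124 π : ℤ) - 122 := by
      simp only [partitionCrank, ce]
      split_ifs <;> omega
    rw [choose_cz, e1]
    unfold Int.ModEq; omega
  have h2 : crankVal 36 250 124 1125000 % 5 = 0 := mod_conv _ _ crank_num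
  refine h1.trans ?_
  generalize crankVal 36 250 124 1125000 = v at h2
  unfold Int.ModEq; omega

end Spt

/-- Sharpness example: `spt₃(124) ≡ 1 (mod 5)` where `spt₃ = μ₆ − η₆`. -/
theorem stmt6 : mu6 124 - eta6 124 ≡ 1 [ZMOD (5 : ℤ)] := by
  have h := Spt.mu_mod.sub Spt.eta_mod
  exact h.trans (by decide)
end

section
/- spt₄((7²·47+1)/24) ≡ 4 (mod 7), i.e. spt₄(96) ≡ 4 (mod 7). -/
/-- Sixth symmetrized crank moment `μ₈(n) = Σ_m C(m+3,8)·M(m,n)`. -/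
noncomputable def mu8 (n : ℕ) : ℤ :=
  ∑ π : n.Partition, Ring.choose (partitionCrank π + 3) 8

/-- Sixth symmetrized rank moment `η₈(n) = Σ_m C(m+3,8)·N(m,n)`. -/
noncomputable def eta8 (n : ℕ) : ℤ :=
  ∑ π : n.Partition, Ring.choose (partitionRank π + 3) 8

/-- Forces evaluation of the argument. -/
def force (x : ℕ) (f : ℕ → ℕ) : ℕ :=
  match x with
  | 0 => f 0
  | n + 1 => f (n + 1)

/-- Truncated geometric series `old + x old + x² old + …` modulo `2 ^ K`, with `x = 2 ^ sh`. -/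
def geo (K sh old : ℕ) : ℕ → ℕ
  | 0 => old
  | i + 1 => (old + (geo K sh old i) <<< sh) &&& (2 ^ K - 1)

/-- Sum of `digit k * f k` over base `2 ^ b` digits. -/
def ev (b : ℕ) (f : ℕ → ℕ) : ℕ → ℕ → ℕ → ℕ
  | 0, _, _ => 0
  | K + 1, k, V => force V fun V => (V % 2 ^ b) * f k + ev b f K (k + 1) (V / 2 ^ b)

/-- The `n`-th digit in base `2 ^ q`. -/
def dig (q n R : ℕ) : ℕ := (R >>> (q * n)) % 2 ^ q

/-- Next row: from parts `≤ j` to parts `≤ j + 1`. -/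
def nextRow (q N e j R : ℕ) : ℕ := geo (q * N) (e + q * (j + 1)) R (N / (j + 1))

/-- Next row for the crank: from `ω` to `ω + 1`. -/
def nextCrank (q N b w R : ℕ) : ℕ :=
  geo (q * N) (0 + q * (w + 1))
    (R + (2 ^ (q * N) - ((R <<< (b + q * (w + 1))) &&& (2 ^ (q * N) - 1)))) (N / (w + 1))

/-- Iterate `nxt`. -/
def iter (nxt : ℕ → ℕ → ℕ) : ℕ → ℕ → ℕ → ℕ
  | 0, _, R => R
  | k + 1, j, R => force (nxt j R) fun R => iter nxt k (j + 1) R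

/-- Iterate `nxt` and accumulate `out`. -/
def loop (nxt out : ℕ → ℕ → ℕ) : ℕ → ℕ → ℕ → ℕ → ℕ
  | 0, _, _, acc => acc
  | k + 1, j, R, acc => force (nxt j R) fun R => force (acc + out (j + 1) R) fun acc =>
      loop nxt out k (j + 1) R acc

/-- `C(y, 8)` modulo 7. -/
def fch (y : ℕ) : ℕ := (y % 7) * (y / 7 % 7)

/-- The rank output. -/
def outEta (n b q j R : ℕ) : ℕ := ev b (fun k => fch (j + 100 - k)) (n + 1) 0 (dig q (n - j) R)

/-- The crank output for partitions without ones. -/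
def outMu0 (n q j R : ℕ) : ℕ := fch (j + 101) * dig q (n - j) R

/-- The crank output for partitions with `w` ones. -/
def outMu (n b q w R : ℕ) : ℕ := ev b (fun k => fch (k + 101 - w)) (n + 1) 0 (dig q (n - w) R)

/-- Rank computation. -/
def compEta (b : ℕ) : ℕ :=
  loop (nextRow (b * (b + 1)) (b + 1) b) (outEta b b (b * (b + 1))) b 0 1 0

/-- Crank computation, no ones. -/
def compMu0 (b : ℕ) : ℕ :=
  loop (nextRow (b * (b + 1)) (b + 1) 0) (outMu0 b (b * (b + 1))) (b - 1) 1 1 0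

/-- Crank computation, with ones. -/
def compMu (b : ℕ) : ℕ :=
  force (iter (nextRow (b * (b + 1)) (b + 1) b) (b - 1) 1 1) fun R =>
    loop (nextCrank (b * (b + 1)) (b + 1) b) (outMu b b (b * (b + 1))) (b - 1) 1 R
      (outMu b b (b * (b + 1)) 1 R)

theorem force_eq (x : ℕ) (f : ℕ → ℕ) : force x f = f x := by
  cases x <;> rfl

theorem geo_spec (K sh old : ℕ) (y : ZMod (2 ^ K))
    (hy : y = old + (2 : ZMod (2 ^ K)) ^ sh * y) (i : ℕ) :
    y - (geo K sh old i : ZMod (2 ^ K)) = ((2 : ZMod (2 ^ K)) ^ sh) ^ (i + 1) * y := by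
  induction i with
  | zero => simp only [geo]; linear_combination hy
  | succ i ih =>
    have : ((geo K sh old (i + 1) : ℕ) : ZMod (2 ^ K))
        = old + (2 : ZMod (2 ^ K)) ^ sh * (geo K sh old i : ZMod (2 ^ K)) := by
      rw [geo, Nat.and_two_pow_sub_one_eq_mod, ZMod.natCast_mod, Nat.shiftLeft_eq]
      push_cast
      ring
    rw [this]
    linear_combination hy + (2 : ZMod (2 ^ K)) ^ sh * ih

theorem two_pow_zero (K m : ℕ) (h : K ≤ m) : (2 : ZMod (2 ^ K)) ^ m = 0 := by
  have h1 : (((2 ^ K : ℕ)) : ZMod (2 ^ K)) = 0 := ZMod.natCast_self _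
  push_cast at h1
  exact pow_eq_zero_of_le h h1

theorem geo_eq (q N e s old : ℕ) (hs : 0 < s) (y : ZMod (2 ^ (q * N)))
    (hy : y = old + (2 : ZMod (2 ^ (q * N))) ^ (e + q * s) * y) :
    ((geo (q * N) (e + q * s) old (N / s) : ℕ) : ZMod (2 ^ (q * N))) = y := by
  have h := geo_spec _ _ old y hy (N / s)
  rw [← pow_mul, two_pow_zero, zero_mul, sub_eq_zero] at h
  · exact h.symm
  · have h2 : N ≤ s * (N / s + 1) := (Nat.lt_mul_div_succ N hs).le
    calc q * N ≤ q * (s * (N / s + 1)) := Nat.mul_le_mul_left _ h2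
      _ ≤ (e + q * s) * (N / s + 1) := by rw [← mul_assoc]; gcongr; omega

theorem digit_lemma (b : ℕ) (c : ℕ → ℕ) (hc : ∀ i, c i < b) :
    ∀ (N n : ℕ), n < N → (∑ i ∈ Finset.range N, c i * b ^ i) / b ^ n % b = c n := by
  have hb : 0 < b := lt_of_le_of_lt (Nat.zero_le _) (hc 0)
  intro N n
  induction n generalizing N c with
  | zero =>
    intro h
    obtain ⟨N, rfl⟩ : ∃ M, N = M + 1 := ⟨N - 1, by omega⟩
    rw [Finset.sum_range_succ']
    have : ∑ i ∈ Finset.range N, c (i + 1) * b ^ (i + 1)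
        = b * ∑ i ∈ Finset.range N, c (i + 1) * b ^ i := by
      rw [Finset.mul_sum]; exact Finset.sum_congr rfl fun i _ => by ring
    rw [this]
    simp [Nat.mod_eq_of_lt (hc 0)]
  | succ n ih =>
    intro h
    obtain ⟨N, rfl⟩ : ∃ M, N = M + 1 := ⟨N - 1, by omega⟩
    rw [Finset.sum_range_succ']
    have : ∑ i ∈ Finset.range N, c (i + 1) * b ^ (i + 1)
        = b * ∑ i ∈ Finset.range N, c (i + 1) * b ^ i := by
      rw [Finset.mul_sum]; exact Finset.sum_congr rfl fun i _ => by ring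
    rw [this, pow_succ', ← Nat.div_div_eq_div_mul, pow_zero, mul_one, Nat.mul_add_div hb,
      Nat.div_eq_of_lt (hc 0), add_zero]
    exact ih (fun i => c (i + 1)) (fun i => hc _) N (by omega)

theorem dig_eq (q N n R : ℕ) (c : ℕ → ℕ) (hc : ∀ i < N, c i < 2 ^ q) (hn : n < N)
    (hR : (R : ZMod (2 ^ (q * N))) =
      ∑ i ∈ Finset.range N, (c i : ZMod (2 ^ (q * N))) * ((2 : ZMod (2 ^ (q * N))) ^ q) ^ i) :
    dig q n R = c n := by
  have h1 : (R : ZMod (2 ^ (q * N))) =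
      ((∑ i ∈ Finset.range N, (if i < N then c i else 0) * (2 ^ q) ^ i : ℕ) :
        ZMod (2 ^ (q * N))) := by
    rw [hR]; push_cast
    refine Finset.sum_congr rfl fun i hi => ?_
    rw [if_pos (Finset.mem_range.1 hi)]
  rw [ZMod.natCast_eq_natCast_iff] at h1
  have h2 := digit_lemma (2 ^ q) (fun i => if i < N then c i else 0)
    (fun i => by split_ifs with h; exacts [hc i h, by positivity]) N n hn
  rw [if_pos hn] at h2
  rw [dig, Nat.shiftRight_eq_div_pow, pow_mul, ← h2, ← Nat.mod_mul_right_div_self,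
    ← Nat.mod_mul_right_div_self, ← pow_succ]
  congr 1
  have h3 : (2 ^ q) ^ (n + 1) ∣ 2 ^ (q * N) := by
    rw [← pow_mul]; exact pow_dvd_pow _ (Nat.mul_le_mul_left _ hn)
  exact h1.of_dvd h3

theorem ev_eq (b : ℕ) (f : ℕ → ℕ) : ∀ (K k : ℕ) (c : ℕ → ℕ), (∀ i, c i < 2 ^ b) →
    ev b f K k (∑ i ∈ Finset.range K, c i * (2 ^ b) ^ i)
      = ∑ i ∈ Finset.range K, c i * f (k + i) := by
  intro K
  induction K with
  | zero => intro k c _; simp [ev]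
  | succ K ih =>
    intro k c hc
    rw [ev, force_eq]
    have h0 : ∑ i ∈ Finset.range (K + 1), c i * (2 ^ b) ^ i
        = 2 ^ b * (∑ i ∈ Finset.range K, c (i + 1) * (2 ^ b) ^ i) + c 0 := by
      rw [Finset.sum_range_succ', Finset.mul_sum, pow_zero, mul_one]
      congr 1
      exact Finset.sum_congr rfl fun i _ => by ring
    rw [h0, Nat.mul_add_mod, Nat.mod_eq_of_lt (hc 0), Nat.mul_add_div (by positivity),
      Nat.div_eq_of_lt (hc 0), add_zero, ih _ (fun i => c (i + 1)) (fun i => hc _),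
      Finset.sum_range_succ', add_zero, add_comm]
    congr 1
    exact Finset.sum_congr rfl fun i _ => by rw [add_assoc, add_comm 1 i]

theorem ev_sum {α : Type*} (b : ℕ) (f : ℕ → ℕ) (K : ℕ) (T : Finset α) (e : α → ℕ)
    (he : ∀ t ∈ T, e t < K) (hT : T.card < 2 ^ b) :
    ev b f K 0 (∑ t ∈ T, (2 ^ b) ^ e t) = ∑ t ∈ T, f (e t) := by
  have key : ∀ F : ℕ → ℕ, ∑ t ∈ T, F (e t)
      = ∑ i ∈ Finset.range K, (T.filter (fun t => e t = i)).card * F i := by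
    intro F
    rw [← Finset.sum_fiberwise_of_maps_to (s := T) (t := Finset.range K) (g := e)
      (fun t ht => Finset.mem_range.2 (he t ht))]
    refine Finset.sum_congr rfl fun i _ => ?_
    rw [Finset.sum_congr rfl (g := fun _ => F i)
      (fun t ht => by rw [(Finset.mem_filter.1 ht).2]), Finset.sum_const, smul_eq_mul]
  rw [key f, key fun i => (2 ^ b) ^ i, ev_eq]
  · simp
  · intro i
    exact lt_of_le_of_lt (Finset.card_le_card (Finset.filter_subset _ _)) hT

theorem loop_eq (nxt out : ℕ → ℕ → ℕ) (Good : ℕ → ℕ → Prop) (spec : ℕ → ℕ) (J : ℕ)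
    (hn : ∀ j R, j < J → Good j R → Good (j + 1) (nxt j R))
    (ho : ∀ j R, 1 ≤ j → j ≤ J → Good j R → out j R = spec j) :
    ∀ k j R acc, j + k ≤ J → Good j R →
      loop nxt out k j R acc = acc + ∑ i ∈ Finset.range k, spec (j + 1 + i) := by
  intro k
  induction k with
  | zero => intro j R acc _ _; simp [loop]
  | succ k ih =>
    intro j R acc hj hR
    have h1 := hn j R (by omega) hR
    rw [loop, force_eq, force_eq, ih _ _ _ (by omega) h1, ho _ _ (by omega) (by omega) h1,
      Finset.sum_range_succ']
    simp only [add_zero]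
    rw [add_assoc acc, add_comm (spec (j + 1))]
    congr 2
    exact Finset.sum_congr rfl fun i _ => by congr 1; omega

theorem iter_good (nxt : ℕ → ℕ → ℕ) (Good : ℕ → ℕ → Prop)
    (hn : ∀ j R, Good j R → Good (j + 1) (nxt j R)) :
    ∀ k j R, Good j R → Good (j + k) (iter nxt k j R) := by
  intro k
  induction k with
  | zero => intro j R h; simpa [iter] using h
  | succ k ih =>
    intro j R h
    rw [iter, force_eq]
    have := ih _ _ (hn _ _ h)
    rwa [show j + (k + 1) = j + 1 + k by omega]

/-- Multisets of positive integers at most `j` with sum `n`. -/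
def PS (j n : ℕ) : Finset (Multiset ℕ) :=
  ((Finset.univ : Finset n.Partition).image (fun p => p.parts)).filter (fun s => ∀ a ∈ s, a ≤ j)

theorem mem_PS {j n : ℕ} {s : Multiset ℕ} :
    s ∈ PS j n ↔ s.sum = n ∧ (∀ a ∈ s, 0 < a) ∧ ∀ a ∈ s, a ≤ j := by
  simp only [PS, Finset.mem_filter, Finset.mem_image, Finset.mem_univ, true_and]
  constructor
  · rintro ⟨⟨p, rfl⟩, h⟩
    exact ⟨p.parts_sum, fun a ha => p.parts_pos ha, h⟩
  · rintro ⟨h1, h2, h3⟩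
    exact ⟨⟨⟨s, fun {a} ha => h2 a ha, h1⟩, rfl⟩, h3⟩

theorem card_PS (j n : ℕ) : (PS j n).card ≤ 2 ^ (n - 1) := by
  calc (PS j n).card ≤ _ := Finset.card_filter_le _ _
    _ ≤ _ := Finset.card_image_le
    _ = Fintype.card n.Partition := rfl
    _ ≤ Fintype.card (Composition n) :=
        Fintype.card_le_of_surjective _ Nat.Partition.ofComposition_surj
    _ = _ := composition_card n

theorem sum_PS {M : Type*} [AddCommMonoid M] (n : ℕ) (F : Multiset ℕ → M) :
    ∑ p : n.Partition, F p.parts = ∑ s ∈ PS n n, F s := by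
  have h : PS n n = (Finset.univ : Finset n.Partition).image (fun p => p.parts) := by
    apply Finset.filter_true_of_mem
    intro s hs a ha
    obtain ⟨p, -, rfl⟩ := Finset.mem_image.1 hs
    calc a ≤ p.parts.sum := Multiset.single_le_sum (fun _ _ => Nat.zero_le _) a ha
      _ = n := p.parts_sum
  rw [h, Finset.sum_image]
  intro p _ p' _ h
  exact Nat.Partition.ext h

theorem card_le_of_mem {j n : ℕ} {s : Multiset ℕ} (h : s ∈ PS j n) : s.card ≤ n := by
  obtain ⟨h1, h2, -⟩ := mem_PS.1 h
  have := Multiset.card_nsmul_le_sum (s := s) (a := 1) h2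
  simpa [h1] using this

theorem PS_succ_lt {j n : ℕ} (h : n < j + 1) : PS (j + 1) n = PS j n := by
  ext s
  rw [mem_PS, mem_PS]
  constructor
  · rintro ⟨h1, h2, h3⟩
    refine ⟨h1, h2, fun a ha => ?_⟩
    have := Multiset.single_le_sum (fun _ _ => Nat.zero_le _) a ha
    omega
  · rintro ⟨h1, h2, h3⟩
    exact ⟨h1, h2, fun a ha => (h3 a ha).trans (Nat.le_succ _)⟩

theorem PS_succ {M : Type*} [AddCommMonoid M] {j n : ℕ} (h : j + 1 ≤ n) (F : Multiset ℕ → M) :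
    ∑ s ∈ PS (j + 1) n, F s
      = ∑ s ∈ PS j n, F s + ∑ s ∈ PS (j + 1) (n - (j + 1)), F ((j + 1) ::ₘ s) := by
  have hU : PS (j + 1) n
      = PS j n ∪ (PS (j + 1) (n - (j + 1))).image (fun s => (j + 1) ::ₘ s) := by
    ext s
    simp only [Finset.mem_union, Finset.mem_image, mem_PS]
    constructor
    · rintro ⟨h1, h2, h3⟩
      by_cases hs : j + 1 ∈ s
      · right
        obtain ⟨t, rfl⟩ := Multiset.exists_cons_of_mem hs
        rw [Multiset.sum_cons] at h1
        exact ⟨t, ⟨by omega, fun a ha => h2 a (Multiset.mem_cons_of_mem ha),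
          fun a ha => h3 a (Multiset.mem_cons_of_mem ha)⟩, rfl⟩
      · left
        refine ⟨h1, h2, fun a ha => ?_⟩
        have := h3 a ha
        have h4 : a ≠ j + 1 := by rintro rfl; exact hs ha
        omega
    · rintro (⟨h1, h2, h3⟩ | ⟨t, ⟨h1, h2, h3⟩, rfl⟩)
      · exact ⟨h1, h2, fun a ha => (h3 a ha).trans (Nat.le_succ _)⟩
      · refine ⟨by rw [Multiset.sum_cons]; omega, ?_, ?_⟩
        · intro a ha
          rcases Multiset.mem_cons.1 ha with rfl | ha
          · omega
          · exact h2 a ha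
        · intro a ha
          rcases Multiset.mem_cons.1 ha with rfl | ha
          · omega
          · exact h3 a ha
  rw [hU, Finset.sum_union, Finset.sum_image]
  · intro s _ t _ hst
    exact (Multiset.cons_inj_right _).1 hst
  · rw [Finset.disjoint_left]
    intro s hs hs'
    obtain ⟨t, -, rfl⟩ := Finset.mem_image.1 hs'
    have := (mem_PS.1 hs).2.2 (j + 1) (Multiset.mem_cons_self _ _)
    omega

theorem PS_zero_pos {n : ℕ} (h : 0 < n) : PS 0 n = ∅ := by
  ext s
  simp only [mem_PS, Finset.notMem_empty, iff_false]
  rintro ⟨h1, h2, h3⟩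
  have : s = 0 := Multiset.eq_zero_of_forall_notMem fun a ha => by
    have := h2 a ha; have := h3 a ha; omega
  subst this
  simp at h1; omega

theorem PS_zero_zero : PS 0 0 = {0} := by
  ext s
  simp only [mem_PS, Finset.mem_singleton]
  constructor
  · rintro ⟨h1, h2, h3⟩
    exact Multiset.eq_zero_of_forall_notMem fun a ha => by
      have := h2 a ha; have := h3 a ha; omega
  · rintro rfl; simp

theorem PS_split {M : Type*} [AddCommMonoid M] (n : ℕ) (hn : 0 < n) (F : Multiset ℕ → M) :
    ∀ J, J ≤ n → ∑ s ∈ PS J n, F s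
      = ∑ j ∈ Finset.range J, ∑ s ∈ PS (j + 1) (n - (j + 1)), F ((j + 1) ::ₘ s) := by
  intro J
  induction J with
  | zero => intro _; simp [PS_zero_pos hn]
  | succ J ih => intro hJ; rw [PS_succ hJ, ih (by omega), Finset.sum_range_succ]

/-- Weighted partition count. -/
def W (g : ℕ → ℕ) (j n : ℕ) : ℕ := ∑ s ∈ PS j n, (s.map g).prod

/-- Truncated generating function. -/
def S (q N : ℕ) (g : ℕ → ℕ) (j : ℕ) : ZMod (2 ^ (q * N)) :=
  ∑ i ∈ Finset.range N, (W g j i : ZMod (2 ^ (q * N))) * ((2 : ZMod (2 ^ (q * N))) ^ q) ^ i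

theorem S_ext (q N : ℕ) (c : ℕ → ZMod (2 ^ (q * N))) (m : ℕ) :
    ∑ i ∈ Finset.range (m + N), c i * ((2 : ZMod (2 ^ (q * N))) ^ q) ^ i
      = ∑ i ∈ Finset.range N, c i * ((2 : ZMod (2 ^ (q * N))) ^ q) ^ i := by
  rw [add_comm, Finset.sum_range_add]
  rw [Finset.sum_eq_zero (s := Finset.range m), add_zero]
  intro i _
  rw [← pow_mul, two_pow_zero, mul_zero]
  exact Nat.mul_le_mul_left _ (by omega)

theorem S_succ (q N : ℕ) (g : ℕ → ℕ) (j : ℕ) :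
    S q N g (j + 1) = S q N g j
      + (g (j + 1) : ZMod (2 ^ (q * N))) * (2 : ZMod (2 ^ (q * N))) ^ (q * (j + 1))
        * S q N g (j + 1) := by
  have hW : ∀ n, (W g (j + 1) n : ZMod (2 ^ (q * N))) = W g j n +
      (if j + 1 ≤ n then (g (j + 1) : ZMod (2 ^ (q * N))) * W g (j + 1) (n - (j + 1)) else 0) := by
    intro n
    split_ifs with h
    · unfold W
      rw [PS_succ h]
      push_cast
      simp [Finset.mul_sum]
    · rw [add_zero, W, W, PS_succ_lt (by omega)]
  conv_lhs => rw [S, ← S_ext q N _ (j + 1)]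
  rw [Finset.sum_congr rfl fun n _ => congrArg (· * ((2 : ZMod (2 ^ (q * N))) ^ q) ^ n) (hW n)]
  simp only [add_mul, Finset.sum_add_distrib]
  congr 1
  · rw [S, ← S_ext q N _ (j + 1)]
  · rw [Finset.sum_range_add, Finset.sum_eq_zero, zero_add, S, Finset.mul_sum]
    · refine Finset.sum_congr rfl fun i _ => ?_
      rw [if_pos (by omega), Nat.add_sub_cancel_left, pow_add, ← pow_mul]
      ring
    · intro i hi
      rw [Finset.mem_range] at hi
      rw [if_neg (by omega), zero_mul]

theorem S_zero (q N : ℕ) (hN : 0 < N) (g : ℕ → ℕ) : S q N g 0 = 1 := by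
  rw [S, Finset.sum_eq_single 0]
  · simp [W, PS_zero_zero]
  · intro i _ hi
    simp [W, PS_zero_pos (Nat.pos_of_ne_zero hi)]
  · intro h; exact absurd (Finset.mem_range.2 hN) h

theorem S_prod (q N : ℕ) (hN : 0 < N) (g : ℕ → ℕ) (j : ℕ) :
    (∏ i ∈ Finset.range j, (1 - (g (i + 1) : ZMod (2 ^ (q * N)))
      * (2 : ZMod (2 ^ (q * N))) ^ (q * (i + 1)))) * S q N g j = 1 := by
  induction j with
  | zero => simp [S_zero q N hN]
  | succ j ih =>
    rw [Finset.prod_range_succ]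
    have := S_succ q N g j
    refine Eq.trans ?_ ih
    rw [mul_assoc]
    congr 1
    linear_combination this

theorem nextRow_good (q N e j R : ℕ) (g : ℕ → ℕ) (hg : g (j + 1) = 2 ^ e)
    (h : (R : ZMod (2 ^ (q * N))) = S q N g j) :
    ((nextRow q N e j R : ℕ) : ZMod (2 ^ (q * N))) = S q N g (j + 1) := by
  apply geo_eq _ _ _ _ _ (Nat.succ_pos j)
  rw [h]
  conv_lhs => rw [S_succ, hg]
  push_cast
  rw [pow_add]

/-- Crank weights. -/
def gw (b w a : ℕ) : ℕ := if a = 1 then 0 else if w < a then 2 ^ b else 1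

theorem nextCrank_good (q N b w R J : ℕ) (hN : 0 < N) (hw : 1 ≤ w) (hJ : w < J)
    (h : (R : ZMod (2 ^ (q * N))) = S q N (gw b w) J) :
    ((nextCrank q N b w R : ℕ) : ZMod (2 ^ (q * N))) = S q N (gw b (w + 1)) J := by
  apply geo_eq _ _ _ _ _ (Nat.succ_pos w)
  have hle : ((R <<< (b + q * (w + 1))) &&& (2 ^ (q * N) - 1)) ≤ 2 ^ (q * N) := by
    rw [Nat.and_two_pow_sub_one_eq_mod]
    exact (Nat.mod_lt _ (by positivity)).le
  rw [Nat.cast_add, Nat.cast_sub hle, Nat.and_two_pow_sub_one_eq_mod, ZMod.natCast_mod,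
    ZMod.natCast_self, Nat.shiftLeft_eq, Nat.cast_mul, h, zero_add, pow_add]
  push_cast
  have p1 := S_prod q N hN (gw b w) J
  have p2 := S_prod q N hN (gw b (w + 1)) J
  have hmem : w ∈ Finset.range J := Finset.mem_range.2 hJ
  rw [← Finset.mul_prod_erase _ _ hmem] at p1 p2
  have hE : ∏ i ∈ (Finset.range J).erase w, (1 - (gw b w (i + 1) : ZMod (2 ^ (q * N)))
      * (2 : ZMod (2 ^ (q * N))) ^ (q * (i + 1)))
      = ∏ i ∈ (Finset.range J).erase w, (1 - (gw b (w + 1) (i + 1) : ZMod (2 ^ (q * N)))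
      * (2 : ZMod (2 ^ (q * N))) ^ (q * (i + 1))) := by
    refine Finset.prod_congr rfl fun i hi => ?_
    have hi := (Finset.mem_erase.1 hi).1
    have : gw b w (i + 1) = gw b (w + 1) (i + 1) := by
      unfold gw
      split_ifs <;> first | rfl | omega
    rw [this]
  rw [hE] at p1
  have g1 : gw b w (w + 1) = 2 ^ b := by
    unfold gw; rw [if_neg (by omega), if_pos (by omega)]
  have g2 : gw b (w + 1) (w + 1) = 1 := by
    unfold gw; rw [if_neg (by omega), if_neg (by omega)]
  rw [g1] at p1
  rw [g2] at p2
  push_cast at p1 p2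
  generalize S q N (gw b w) J = s at *
  generalize S q N (gw b (w + 1)) J = t at *
  generalize (2 : ZMod (2 ^ (q * N))) ^ (q * (w + 1)) = x at *
  generalize ∏ i ∈ (Finset.range J).erase w, (1 - (gw b (w + 1) (i + 1) : ZMod (2 ^ (q * N)))
      * (2 : ZMod (2 ^ (q * N))) ^ (q * (i + 1))) = E at *
  linear_combination (1 - 2 ^ b * x) * s * p2 - (1 - x) * t * p1


theorem choose_prod (x : ℤ) : 40320 * Ring.choose x 8
    = x * (x - 1) * (x - 2) * (x - 3) * (x - 4) * (x - 5) * (x - 6) * (x - 7) := by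
  have h := Ring.descPochhammer_eq_factorial_smul_choose x 8
  rw [← Polynomial.eval_eq_smeval, descPochhammer_eval_eq_prod_range] at h
  simp only [Finset.prod_range_succ, Finset.prod_range_zero, nsmul_eq_mul] at h
  norm_num [Nat.factorial] at h
  linarith

theorem choose_eq (y : ℕ) :
    ((Ring.choose ((y : ℤ) - 98) 8 : ℤ) : ZMod 7) = (fch y : ZMod 7) := by
  have h := choose_prod ((y : ℤ) - 98)
  generalize Ring.choose ((y : ℤ) - 98) 8 = c at *
  have h1 : ((40320 * c : ℤ) : ZMod 49) = ((40320 * (fch y : ℤ) : ℤ) : ZMod 49) := by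
    rw [h]
    have key : ∀ r : ZMod 49, r * (r - 1) * (r - 2) * (r - 3) * (r - 4) * (r - 5) * (r - 6)
        * (r - 7) = 40320 * ((fch r.val : ℕ) : ZMod 49) := by
      decide +kernel
    have h98 : ((y : ℤ) - 98 : ZMod 49) = ((y % 49 : ℕ) : ZMod 49) := by
      have : (98 : ZMod 49) = 0 := by decide
      rw [this]; simp
    have hf : fch (y % 49) = fch y := by
      unfold fch
      rw [show y % 49 % 7 = y % 7 by omega, show y % 49 / 7 % 7 = y / 7 % 7 by omega]
    have hk := key ((y % 49 : ℕ) : ZMod 49)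
    rw [ZMod.val_natCast, Nat.mod_mod, hf] at hk
    push_cast at h98 ⊢
    rw [h98]
    exact hk
  rw [ZMod.intCast_eq_intCast_iff] at h1
  have h2 : (c : ZMod 7) = (((fch y : ℤ) : ℤ) : ZMod 7) := by
    rw [ZMod.intCast_eq_intCast_iff]
    unfold Int.ModEq at *
    push_cast at h1 ⊢
    omega
  simpa using h2

theorem prod_le_pow (B : ℕ) (g : ℕ → ℕ) (hg : ∀ a, g a ≤ B) (s : Multiset ℕ) :
    (s.map g).prod ≤ B ^ s.card := by
  induction s using Multiset.induction with
  | empty => simp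
  | cons a s ih =>
    rw [Multiset.map_cons, Multiset.prod_cons, Multiset.card_cons, pow_succ']
    exact Nat.mul_le_mul (hg a) ih

theorem card_PS_lt (b j n : ℕ) (hb : 0 < b) (hn : n ≤ b) : (PS j n).card < 2 ^ b :=
  lt_of_le_of_lt (card_PS j n) (Nat.pow_lt_pow_right (by norm_num) (by omega))

theorem W_lt (b : ℕ) (hb : 0 < b) (g : ℕ → ℕ) (hg : ∀ a, g a ≤ 2 ^ b) (j n : ℕ) (hn : n ≤ b) :
    W g j n < 2 ^ (b * (b + 1)) := by
  have h1 : W g j n ≤ (PS j n).card * (2 ^ b) ^ b := by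
    rw [W, ← smul_eq_mul]
    apply Finset.sum_le_card_nsmul
    intro s hs
    exact (prod_le_pow _ g hg s).trans
      (Nat.pow_le_pow_right (by positivity) ((card_le_of_mem hs).trans hn))
  calc W g j n ≤ _ := h1
    _ < 2 ^ b * (2 ^ b) ^ b := Nat.mul_lt_mul_of_pos_right (card_PS_lt b j n hb hn) (by positivity)
    _ = 2 ^ (b * (b + 1)) := by rw [← pow_succ', ← pow_mul]

theorem gw_le (b w a : ℕ) : gw b w a ≤ 2 ^ b := by
  unfold gw
  have : 1 ≤ 2 ^ b := Nat.one_le_two_pow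
  split_ifs <;> omega

theorem prod_gw (b w : ℕ) (s : Multiset ℕ) : (s.map (gw b w)).prod
    = if 1 ∈ s then 0 else (2 ^ b) ^ (s.filter (fun a => w < a)).card := by
  induction s using Multiset.induction with
  | empty => simp
  | cons a s ih =>
    rw [Multiset.map_cons, Multiset.prod_cons, ih]
    by_cases h1 : a = 1
    · subst h1; simp [gw]
    · by_cases h2 : 1 ∈ s
      · simp [h2]
      · have h3 : ¬ (1 ∈ a ::ₘ s) := by
          rw [Multiset.mem_cons]; rintro (h | h)
          · exact h1 h.symm
          · exact h2 h
        rw [if_neg h2, if_neg h3]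
        by_cases h4 : w < a
        · rw [Multiset.filter_cons_of_pos _ h4, Multiset.card_cons, pow_succ', gw, if_neg h1,
            if_pos h4]
        · rw [Multiset.filter_cons_of_neg _ h4, gw, if_neg h1, if_neg h4, one_mul]

theorem W_gw (b w j n : ℕ) : W (gw b w) j n = ∑ s ∈ (PS j n).filter (fun s => ¬ 1 ∈ s),
    (2 ^ b) ^ (s.filter (fun a => w < a)).card := by
  rw [Finset.sum_filter, W]
  refine Finset.sum_congr rfl fun s _ => ?_
  rw [prod_gw]
  split_ifs <;> rfl

theorem W_const (b j n : ℕ) : W (fun _ => 2 ^ b) j n = ∑ s ∈ PS j n, (2 ^ b) ^ s.card := by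
  rw [W]
  refine Finset.sum_congr rfl fun s _ => ?_
  rw [Multiset.map_const', Multiset.prod_replicate]

theorem S_gw_one (q N : ℕ) (hN : 0 < N) (b w : ℕ) : S q N (gw b w) 1 = 1 := by
  rw [S_succ q N (gw b w) 0, S_zero q N hN]
  simp [gw]

theorem dig_S (b n R j : ℕ) (hb : 0 < b) (g : ℕ → ℕ) (hg : ∀ a, g a ≤ 2 ^ b) (hn : n ≤ b)
    (h : (R : ZMod (2 ^ ((b * (b + 1)) * (b + 1)))) = S (b * (b + 1)) (b + 1) g j) :
    dig (b * (b + 1)) n R = W g j n :=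
  dig_eq (b * (b + 1)) (b + 1) n R (W g j)
    (fun i hi => W_lt b hb g hg j i (by omega)) (by omega) h

/-- Value of the rank output. -/
def specE (n j : ℕ) : ℕ := ∑ s ∈ PS j (n - j), fch (j + 100 - s.card)

/-- Value of the crank output without ones. -/
def specM0 (n j : ℕ) : ℕ := ∑ s ∈ (PS j (n - j)).filter (fun s => ¬ 1 ∈ s), (fun _ => fch (j + 101)) s

/-- Value of the crank output with `w` ones. -/
def specM (n w : ℕ) : ℕ := ∑ s ∈ (PS n (n - w)).filter (fun s => ¬ 1 ∈ s),
  fch ((s.filter (fun a => w < a)).card + 101 - w)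

theorem outEta_eq (b j R : ℕ) (hb : 0 < b)
    (h : (R : ZMod (2 ^ ((b * (b + 1)) * (b + 1))))
      = S (b * (b + 1)) (b + 1) (fun _ => 2 ^ b) j) :
    outEta b b (b * (b + 1)) j R = specE b j := by
  rw [outEta, dig_S b _ R j (by omega) _ (fun _ => le_rfl) (by omega) h, W_const, ev_sum]
  · rfl
  · intro t ht
    have := card_le_of_mem ht
    omega
  · exact card_PS_lt b _ _ (by omega) (by omega)

theorem outMu0_eq (b j R : ℕ) (hb : 0 < b)
    (h : (R : ZMod (2 ^ ((b * (b + 1)) * (b + 1))))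
      = S (b * (b + 1)) (b + 1) (gw 0 0) j) :
    outMu0 b (b * (b + 1)) j R = specM0 b j := by
  rw [outMu0, dig_S b _ R j (by omega) _
    (fun a => (gw_le 0 0 a).trans (Nat.pow_le_pow_right (by norm_num) (Nat.zero_le _)))
    (by omega) h, W_gw]
  simp [specM0, mul_comm]

theorem outMu_eq (b w R : ℕ) (hb : 0 < b)
    (h : (R : ZMod (2 ^ ((b * (b + 1)) * (b + 1))))
      = S (b * (b + 1)) (b + 1) (gw b w) b) :
    outMu b b (b * (b + 1)) w R = specM b w := by
  rw [outMu, dig_S b _ R b (by omega) _ (gw_le b w) (by omega) h, W_gw, ev_sum]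
  · rfl
  · intro t ht
    have h1 := card_le_of_mem (Finset.mem_filter.1 ht).1
    have h2 : (t.filter (fun a => w < a)).card ≤ t.card :=
      Multiset.card_le_card (Multiset.filter_le _ _)
    omega
  · exact lt_of_le_of_lt (Finset.card_filter_le _ _) (card_PS_lt b _ _ (by omega) (by omega))

theorem loopEta (b : ℕ) (hb : 0 < b) :
    compEta b = ∑ i ∈ Finset.range b, specE b (i + 1) := by
  rw [compEta, loop_eq _ _ (fun j R => (R : ZMod (2 ^ ((b * (b + 1)) * (b + 1))))
      = S (b * (b + 1)) (b + 1) (fun _ => 2 ^ b) j) (specE b) b]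
  · rw [zero_add]
    exact Finset.sum_congr rfl fun i _ => by congr 1; omega
  · intro j R _ h
    exact nextRow_good _ _ _ _ _ _ rfl h
  · intro j R _ _ h
    exact outEta_eq b j R hb h
  · omega
  · rw [S_zero _ _ (by omega)]; simp

theorem loopMu0 (b : ℕ) (hb : 0 < b) :
    compMu0 b = ∑ i ∈ Finset.range (b - 1), specM0 b (i + 2) := by
  rw [compMu0, loop_eq _ _ (fun j R => 1 ≤ j ∧ (R : ZMod (2 ^ ((b * (b + 1)) * (b + 1))))
      = S (b * (b + 1)) (b + 1) (gw 0 0) j) (specM0 b) b]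
  · rw [zero_add]
    exact Finset.sum_congr rfl fun i _ => by congr 1; omega
  · rintro j R _ ⟨h1, h⟩
    refine ⟨by omega, nextRow_good _ _ _ _ _ _ ?_ h⟩
    unfold gw; rw [if_neg (by omega), if_pos (by omega)]
  · intro j R _ _ h
    exact outMu0_eq b j R hb h.2
  · omega
  · refine ⟨le_rfl, ?_⟩
    rw [S_gw_one _ _ (by omega)]; simp

theorem loopMu (b : ℕ) (hb : 0 < b) :
    compMu b = ∑ i ∈ Finset.range b, specM b (i + 1) := by
  rw [compMu, force_eq]
  have h0 := iter_good (nextRow (b * (b + 1)) (b + 1) b)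
    (fun j R => 1 ≤ j ∧ (R : ZMod (2 ^ ((b * (b + 1)) * (b + 1))))
      = S (b * (b + 1)) (b + 1) (gw b 1) j)
    (by
      rintro j R ⟨h1, h⟩
      refine ⟨by omega, nextRow_good _ _ _ _ _ _ ?_ h⟩
      unfold gw; rw [if_neg (by omega), if_pos (by omega)]) (b - 1) 1 1
    ⟨le_rfl, by rw [S_gw_one _ _ (by omega)]; simp⟩
  generalize iter (nextRow (b * (b + 1)) (b + 1) b) (b - 1) 1 1 = R at *
  have h1 := h0.2
  rw [show 1 + (b - 1) = b by omega] at h1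
  rw [loop_eq _ _ (fun w R => 1 ≤ w ∧ (R : ZMod (2 ^ ((b * (b + 1)) * (b + 1))))
      = S (b * (b + 1)) (b + 1) (gw b w) b) (specM b) b]
  · obtain ⟨d, rfl⟩ : ∃ d, b = d + 1 := ⟨b - 1, by omega⟩
    rw [outMu_eq _ 1 R hb h1, Nat.add_sub_cancel, Finset.sum_range_succ',
      add_comm (specM (d + 1) 1)]
    refine congrArg₂ (· + ·) (Finset.sum_congr rfl fun i _ => ?_) rfl
    rw [show 1 + 1 + i = i + 1 + 1 by omega]
  · rintro w R hw ⟨h2, h⟩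
    exact ⟨by omega, nextCrank_good _ _ _ _ _ _ (by omega) h2 hw h⟩
  · intro j R _ _ h
    exact outMu_eq b j R hb h.2
  · omega
  · exact ⟨le_rfl, h1⟩

theorem sup_cons {j n : ℕ} {s : Multiset ℕ} (h : s ∈ PS (j + 1) n) :
    ((j + 1) ::ₘ s).sup = j + 1 := by
  rw [Multiset.sup_cons]
  exact sup_eq_left.2 (Multiset.sup_le.2 (mem_PS.1 h).2.2)

theorem eta_cast (b : ℕ) (hb : 0 < b) (hb2 : b ≤ 98) :
    ((eta8 b : ℤ) : ZMod 7) = ((∑ i ∈ Finset.range b, specE b (i + 1) : ℕ) : ZMod 7) := by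
  unfold eta8 partitionRank
  rw [Int.cast_sum, sum_PS b (fun s => ((Ring.choose ((s.sup : ℤ) - (s.card : ℤ) + 3) 8 : ℤ) :
    ZMod 7)), PS_split b hb _ b le_rfl, Nat.cast_sum]
  refine Finset.sum_congr rfl fun j hj => ?_
  rw [Finset.mem_range] at hj
  rw [specE, Nat.cast_sum]
  refine Finset.sum_congr rfl fun s hs => ?_
  have hc := card_le_of_mem hs
  rw [sup_cons hs, Multiset.card_cons, ← choose_eq]
  congr 2
  omega

theorem mu_cast (b : ℕ) (hb : 0 < b) (hb2 : b ≤ 98) : ((mu8 b : ℤ) : ZMod 7) =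
    ((∑ i ∈ Finset.range (b - 1), specM0 b (i + 2) + ∑ i ∈ Finset.range b, specM b (i + 1) : ℕ) :
      ZMod 7) := by
  unfold mu8 partitionCrank
  rw [Int.cast_sum, sum_PS b (fun s => ((Ring.choose ((if s.count 1 = 0 then (s.sup : ℤ)
    else ((s.filter (fun a => s.count 1 < a)).card : ℤ) - (s.count 1 : ℤ)) + 3) 8 : ℤ) :
    ZMod 7))]
  rw [← Finset.sum_filter_add_sum_filter_not _ (fun s => s.count 1 = 0), Nat.cast_add]
  refine congrArg₂ (· + ·) ?_ ?_
  · obtain ⟨d, rfl⟩ : ∃ d, b = d + 1 := ⟨b - 1, by omega⟩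
    rw [Finset.sum_filter, PS_split (d + 1) hb _ (d + 1) le_rfl, Finset.sum_range_succ',
      Nat.cast_sum, Finset.sum_eq_zero (s := PS (0 + 1) _), add_zero]
    · refine Finset.sum_congr rfl fun j hj => ?_
      rw [Finset.mem_range] at hj
      rw [specM0, Nat.cast_sum, Finset.sum_filter]
      refine Finset.sum_congr rfl fun s hs => ?_
      have h1 : ((j + 1 + 1) ::ₘ s).count 1 = s.count 1 :=
        Multiset.count_cons_of_ne (by omega) _
      rw [h1]
      by_cases h : 1 ∈ s
      · rw [if_neg (fun h0 => Multiset.count_eq_zero.1 h0 h), if_neg (not_not.2 h)]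
      · rw [if_pos (Multiset.count_eq_zero.2 h), if_pos (Multiset.count_eq_zero.2 h), if_pos h,
          sup_cons hs, ← choose_eq]
        congr 2
        push_cast
        ring
    · intro s _
      rw [if_neg]
      simp
  · have hmap : ∀ s ∈ (PS b b).filter (fun s => ¬ s.count 1 = 0),
        s.count 1 - 1 ∈ Finset.range b := by
      intro s hs
      have h1 := card_le_of_mem (Finset.mem_filter.1 hs).1
      have h2 := Multiset.count_le_card 1 s
      have h3 := (Finset.mem_filter.1 hs).2
      rw [Finset.mem_range]; omega
    rw [← Finset.sum_fiberwise_of_maps_to hmap, Nat.cast_sum]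
    refine Finset.sum_congr rfl fun i hi => ?_
    rw [Finset.mem_range] at hi
    rw [specM, Nat.cast_sum]
    symm
    refine Finset.sum_bij (fun s _ => Multiset.replicate (i + 1) 1 + s) ?_ ?_ ?_ ?_
    · intro s hs
      obtain ⟨h1, h2⟩ := Finset.mem_filter.1 hs
      obtain ⟨h3, h4, h5⟩ := mem_PS.1 h1
      have hc : (Multiset.replicate (i + 1) 1 + s).count 1 = i + 1 := by
        rw [Multiset.count_add, Multiset.count_replicate_self, Multiset.count_eq_zero.2 h2]
      rw [Finset.mem_filter, Finset.mem_filter, hc, mem_PS]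
      refine ⟨⟨⟨?_, ?_, ?_⟩, by omega⟩, by omega⟩
      · rw [Multiset.sum_add, Multiset.sum_replicate, h3, smul_eq_mul]; omega
      · intro a ha
        rcases Multiset.mem_add.1 ha with ha | ha
        · rw [Multiset.eq_of_mem_replicate ha]; omega
        · exact h4 a ha
      · intro a ha
        rcases Multiset.mem_add.1 ha with ha | ha
        · rw [Multiset.eq_of_mem_replicate ha]; omega
        · exact h5 a ha
    · intro s _ t _ h
      exact add_left_cancel h
    · intro s hs
      obtain ⟨h0, h6⟩ := Finset.mem_filter.1 hs
      obtain ⟨h1, h2⟩ := Finset.mem_filter.1 h0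
      obtain ⟨h3, h4, h5⟩ := mem_PS.1 h1
      have hc : s.count 1 = i + 1 := by omega
      obtain ⟨t, rfl⟩ := Multiset.le_iff_exists_add.1
        (Multiset.le_count_iff_replicate_le.1 hc.ge)
      refine ⟨t, ?_, rfl⟩
      rw [Multiset.count_add, Multiset.count_replicate_self] at hc
      rw [Multiset.sum_add, Multiset.sum_replicate, smul_eq_mul] at h3
      rw [Finset.mem_filter, mem_PS]
      refine ⟨⟨by omega, fun a ha => h4 a (Multiset.mem_add.2 (Or.inr ha)),
        fun a ha => h5 a (Multiset.mem_add.2 (Or.inr ha))⟩, ?_⟩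
      rw [← Multiset.count_eq_zero]; omega
    · intro s hs
      obtain ⟨h1, h2⟩ := Finset.mem_filter.1 hs
      have hc : (Multiset.replicate (i + 1) 1 + s).count 1 = i + 1 := by
        rw [Multiset.count_add, Multiset.count_replicate_self, Multiset.count_eq_zero.2 h2]
      have hf : (Multiset.replicate (i + 1) 1).filter (fun a => i + 1 < a) = 0 := by
        rw [Multiset.filter_eq_nil]
        intro a ha
        rw [Multiset.eq_of_mem_replicate ha]; omega
      rw [hc, if_neg (by omega), Multiset.filter_add, hf, zero_add, ← choose_eq]
      congr 2
      omega

theorem compEta_eq : compEta 96 % 7 = 3 := by decide +kernel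
theorem compMu_eq : (compMu0 96 + compMu 96) % 7 = 0 := by decide +kernel

/-- Sharpness example: `spt₄(96) ≡ 4 (mod 7)` where `spt₄ = μ₈ − η₈`. -/
theorem stmt7 : mu8 96 - eta8 96 ≡ 4 [ZMOD (7 : ℤ)] := by
  have key : ∀ b, 0 < b → b ≤ 98 → compEta b % 7 = 3 → (compMu0 b + compMu b) % 7 = 0 →
      mu8 b - eta8 b ≡ 4 [ZMOD (7 : ℤ)] := by
    intro b hb hb2 h1 h2
    have h : ((mu8 b - eta8 b : ℤ) : ZMod 7) = ((4 : ℤ) : ZMod 7) := by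
      rw [Int.cast_sub, mu_cast b hb hb2, eta_cast b hb hb2, ← loopEta b hb, ← loopMu0 b hb,
        ← loopMu b hb, ← ZMod.natCast_mod, h2, ← ZMod.natCast_mod (compEta b), h1]
      decide
    exact (ZMod.intCast_eq_intCast_iff _ _ 7).1 h
  exact key 96 (by norm_num) (by norm_num) compEta_eq compMu_eq
end
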